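/- arXiv:2407.02589 — 4 statements merged into one kernel-verified Lean document; each statement's English description precedes it below -/
import Mathlib

section
/- For four i.i.d. standard Gaussian samples Z₁, Z₂, Z₃, Z₄ in ℝ, the probability that exactly two of them exceed the sample mean (Z₁+Z₂+Z₃+Z₄)/4 equals (6/π)·arcsin(1/3). -/
open MeasureTheory ProbabilityTheory

/-- Two orthonormal linear functionals of a standard Gaussian vector are independent standard
Gaussians. -/
lemma measurePreserving_gaussianReal_prod_of_orthonormal {ι : Type*} [Fintype ι] (a b : ι → ℝ)
    (ha : ∑ k, a k ^ 2 = 1) (hb : ∑ k, b k ^ 2 = 1) (hab : ∑ k, a k * b k = 0) :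
    MeasurePreserving (fun z : ι → ℝ => (∑ k, a k * z k, ∑ k, b k * z k))
      (Measure.pi fun _ : ι => gaussianReal 0 1) ((gaussianReal 0 1).prod (gaussianReal 0 1)) := by
  have hm : Measurable (fun z : ι → ℝ => (∑ k, a k * z k, ∑ k, b k * z k)) := by fun_prop
  refine ⟨hm, Measure.ext_of_charFunDual ?_⟩
  have key (c : ℝ) : ∫ x, Complex.exp (c * x * Complex.I) ∂(gaussianReal 0 1)
      = Complex.exp (-(c ^ 2) / 2) := by
    rw [← charFun_apply_real, charFun_gaussianReal]
    simp [neg_div]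
  ext L
  have hL (x y : ℝ) : L (x, y) = L (1, 0) * x + L (0, 1) * y := by
    have : ((x, y) : ℝ × ℝ) = x • (1, 0) + y • (0, 1) := by simp
    rw [this, map_add, map_smul, map_smul, smul_eq_mul, smul_eq_mul]
    ring
  generalize L (1, 0) = s at hL
  generalize L (0, 1) = t at hL
  have hsum : ∑ k, (s * a k + t * b k) ^ 2 = s ^ 2 + t ^ 2 := by
    have : ∀ k, (s * a k + t * b k) ^ 2
        = s ^ 2 * a k ^ 2 + t ^ 2 * b k ^ 2 + 2 * s * t * (a k * b k) := fun k => by ring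
    simp_rw [this, Finset.sum_add_distrib, ← Finset.mul_sum, ha, hb, hab]
    ring
  rw [charFunDual_apply, charFunDual_apply, integral_map hm.aemeasurable (by fun_prop)]
  have h1 (z : ι → ℝ) : Complex.exp (L (∑ k, a k * z k, ∑ k, b k * z k) * Complex.I)
      = ∏ k, Complex.exp ((s * a k + t * b k : ℝ) * z k * Complex.I) := by
    rw [hL, ← Complex.exp_sum, ← Finset.sum_mul, Finset.mul_sum, Finset.mul_sum,
      ← Finset.sum_add_distrib]
    push_cast
    congr 2
    exact Finset.sum_congr rfl fun k _ => by ring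
  have h2 (p : ℝ × ℝ) : Complex.exp (L p * Complex.I)
      = Complex.exp (s * p.1 * Complex.I) * Complex.exp (t * p.2 * Complex.I) := by
    rw [← Complex.exp_add, ← Prod.mk.eta (p := p), hL]
    push_cast
    ring_nf
  simp_rw [h1, h2]
  rw [integral_fintype_prod_eq_prod
      (f := fun k (x : ℝ) => Complex.exp ((s * a k + t * b k : ℝ) * x * Complex.I)),
    integral_prod_mul (fun x : ℝ => Complex.exp (s * x * Complex.I))
      (fun x : ℝ => Complex.exp (t * x * Complex.I))]
  simp_rw [key]
  rw [← Complex.exp_sum, ← Complex.exp_add, ← Finset.sum_div, Finset.sum_neg_distrib]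
  congr 1
  rw [← add_div, ← neg_add]
  congr 2
  exact_mod_cast hsum

/-- In polar coordinates, the standard Gaussian measure on the plane is a radial measure times
Lebesgue measure on angles. -/
lemma exists_gaussianReal_prod_apply_eq_mul_volume :
    ∃ C : ENNReal, ∀ (S : Set (ℝ × ℝ)) (T : Set ℝ), MeasurableSet S → MeasurableSet T →
      (∀ r θ, 0 < r → θ ∈ Set.Ioo (-Real.pi) Real.pi →
        ((r * Real.cos θ, r * Real.sin θ) ∈ S ↔ θ ∈ T)) →
      (gaussianReal 0 1).prod (gaussianReal 0 1) S
        = C * volume (T ∩ Set.Ioo (-Real.pi) Real.pi) := by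
  let g : ℝ → ENNReal := fun r =>
    ENNReal.ofReal r * ENNReal.ofReal ((√(2 * Real.pi))⁻¹ ^ 2 * Real.exp (-r ^ 2 / 2))
  refine ⟨∫⁻ r in Set.Ioi 0, g r, fun S T hS hT h => ?_⟩
  have hpdf : Measurable (gaussianPDF 0 1) := measurable_gaussianPDF 0 1
  rw [gaussianReal_of_var_ne_zero _ one_ne_zero, prod_withDensity hpdf hpdf,
    ← Measure.volume_eq_prod, withDensity_apply _ hS, ← lintegral_indicator hS,
    ← lintegral_comp_polarCoord_symm]
  have heq : ∀ p ∈ polarCoord.target, ENNReal.ofReal p.1 •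
      S.indicator (fun z : ℝ × ℝ => gaussianPDF 0 1 z.1 * gaussianPDF 0 1 z.2) (polarCoord.symm p)
      = g p.1 * T.indicator 1 p.2 := by
    rintro ⟨r, θ⟩ ⟨hr, hθ⟩
    have := h r θ hr hθ
    by_cases hT' : θ ∈ T
    · rw [polarCoord_symm_apply, Set.indicator_of_mem (this.2 hT'), Set.indicator_of_mem hT',
        Pi.one_apply, mul_one, smul_eq_mul, gaussianPDF, gaussianPDF,
        ← ENNReal.ofReal_mul (gaussianPDFReal_nonneg _ _ _)]
      simp only [g, gaussianPDFReal_def]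
      congr 2
      rw [mul_mul_mul_comm, ← Real.exp_add]
      simp only [NNReal.coe_one, mul_one, sub_zero]
      rw [← sq, ← add_div]
      congr 3
      linear_combination -r ^ 2 * Real.sin_sq_add_cos_sq θ
    · rw [polarCoord_symm_apply, Set.indicator_of_notMem (fun hc => hT' (this.1 hc)),
        Set.indicator_of_notMem hT']
      simp
  rw [setLIntegral_congr_fun polarCoord.open_target.measurableSet heq, polarCoord_target,
    Measure.volume_eq_prod, ← Measure.prod_restrict,
    lintegral_prod_mul (f := g) (by fun_prop) (measurable_one.indicator hT).aemeasurable,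
    lintegral_indicator_one hT, Measure.restrict_apply hT]

lemma gaussianReal_prod_real_of_forall_polar {S : Set (ℝ × ℝ)} {T : Set ℝ}
    (hS : MeasurableSet S) (hT : MeasurableSet T)
    (h : ∀ r θ, 0 < r → θ ∈ Set.Ioo (-Real.pi) Real.pi →
        ((r * Real.cos θ, r * Real.sin θ) ∈ S ↔ θ ∈ T)) :
    ((gaussianReal 0 1).prod (gaussianReal 0 1)).real S
      = volume.real (T ∩ Set.Ioo (-Real.pi) Real.pi) / (2 * Real.pi) := by
  obtain ⟨C, hC⟩ := exists_gaussianReal_prod_apply_eq_mul_volume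
  have h1 := congrArg ENNReal.toReal
    (hC Set.univ Set.univ MeasurableSet.univ MeasurableSet.univ (by simp))
  have h2 := congrArg ENNReal.toReal (hC S T hS hT h)
  simp only [measure_univ, Set.univ_inter, Real.volume_Ioo, ENNReal.toReal_mul,
    ENNReal.toReal_one] at h1
  rw [ENNReal.toReal_ofReal (by linarith [Real.pi_pos])] at h1
  rw [Measure.real, h2, ENNReal.toReal_mul, Measure.real]
  have := Real.pi_pos
  rw [eq_div_iff (by positivity)]
  linear_combination -(volume (T ∩ Set.Ioo (-Real.pi) Real.pi)).toReal * h1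

lemma gaussianReal_prod_real_upper_half :
    ((gaussianReal 0 1).prod (gaussianReal 0 1)).real {p | 0 < p.2} = 1 / 2 := by
  have hpi := Real.pi_pos
  rw [gaussianReal_prod_real_of_forall_polar (T := Set.Ioo 0 Real.pi)
    (measurableSet_lt (by fun_prop) (by fun_prop)) measurableSet_Ioo]
  · rw [Set.inter_eq_left.2 (Set.Ioo_subset_Ioo_left (by linarith)),
      Real.volume_real_Ioo_of_le hpi.le]
    field_simp
    ring
  · rintro r θ hr ⟨h1, h2⟩
    simp only [Set.mem_ofPred_eq, Set.mem_Ioo, mul_pos_iff_of_pos_left hr, h2, and_true]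
    refine ⟨fun h => ?_, fun h => Real.sin_pos_of_pos_of_lt_pi h h2⟩
    by_contra! hc
    exact absurd h (not_lt.2 (Real.sin_nonpos_of_nonpos_of_neg_pi_le hc h1.le))

lemma gaussianReal_prod_real_axis :
    ((gaussianReal 0 1).prod (gaussianReal 0 1)).real {p | p.2 = 0} = 0 := by
  rw [gaussianReal_prod_real_of_forall_polar (T := {0})
    (measurableSet_eq_fun (by fun_prop) (by fun_prop)) (measurableSet_singleton 0)]
  · rw [measureReal_def, measure_mono_null Set.inter_subset_left (by simp)]
    simp
  · rintro r θ hr ⟨h1, h2⟩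
    simp [hr.ne', Real.sin_eq_zero_iff_of_lt_of_lt h1 h2]

lemma measurableSet_sector (β : ℝ) :
    MeasurableSet {p : ℝ × ℝ | 0 < p.2 ∧ p.2 * Real.sin β < p.1 * Real.cos β} := by
  rw [Set.ofPred_and]
  exact (measurableSet_lt (by fun_prop) (by fun_prop)).inter
    (measurableSet_lt (by fun_prop) (by fun_prop))

/-- The Gaussian measure of a sector of the plane with opening angle `π / 2 - β`. -/
lemma gaussianReal_prod_real_sector {β : ℝ} (h0 : 0 ≤ β) (h1 : β ≤ Real.pi / 2) :
    ((gaussianReal 0 1).prod (gaussianReal 0 1)).real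
      {p | 0 < p.2 ∧ p.2 * Real.sin β < p.1 * Real.cos β}
      = (Real.pi / 2 - β) / (2 * Real.pi) := by
  have hpi := Real.pi_pos
  rw [gaussianReal_prod_real_of_forall_polar (T := Set.Ioo 0 (Real.pi / 2 - β))
    (measurableSet_sector β) measurableSet_Ioo]
  · rw [Set.inter_eq_left.2 (Set.Ioo_subset_Ioo (by linarith) (by linarith)),
      Real.volume_real_Ioo_of_le (by linarith), sub_zero]
  · rintro r θ hr ⟨h2, h3⟩
    have hcos : r * Real.sin θ * Real.sin β < r * Real.cos θ * Real.cos β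
        ↔ 0 < Real.cos (θ + β) := by
      rw [Real.cos_add, mul_assoc, mul_assoc, mul_lt_mul_iff_right₀ hr, sub_pos]
    simp only [Set.mem_ofPred_eq, Set.mem_Ioo, mul_pos_iff_of_pos_left hr, hcos]
    constructor
    · rintro ⟨hs, hc⟩
      have hθ : 0 < θ := by
        by_contra! hc
        exact absurd hs (not_lt.2 (Real.sin_nonpos_of_nonpos_of_neg_pi_le hc h2.le))
      refine ⟨hθ, ?_⟩
      by_contra! hc'
      exact absurd hc (not_lt.2 (Real.cos_nonpos_of_pi_div_two_le_of_le (by linarith)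
        (by linarith)))
    · rintro ⟨h4, h5⟩
      exact ⟨Real.sin_pos_of_pos_of_lt_pi h4 h3, Real.cos_pos_of_mem_Ioo
        ⟨by linarith, by linarith⟩⟩

/-- Normalised coordinates for two distinct deviations from the mean of four samples. -/
lemma measurePreserving_deviations {i j : Fin 4} (hij : i ≠ j) :
    MeasurePreserving (fun z : Fin 4 → ℝ =>
        (√(3 / 2) * ((z j - (∑ k, z k) / 4) + (z i - (∑ k, z k) / 4) / 3),
          2 / √3 * (z i - (∑ k, z k) / 4)))
      (Measure.pi fun _ : Fin 4 => gaussianReal 0 1)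
      ((gaussianReal 0 1).prod (gaussianReal 0 1)) := by
  have hs : √(3 / 2) ^ 2 = (3 / 2 : ℝ) := Real.sq_sqrt (by norm_num)
  have ht : (2 / √3) ^ 2 = (4 / 3 : ℝ) := by
    rw [div_pow, Real.sq_sqrt (by norm_num)]; norm_num
  generalize √(3 / 2) = s at *
  generalize 2 / √3 = t at *
  let d (l k : Fin 4) : ℝ := (if k = l then 1 else 0) - 1 / 4
  have hd (l : Fin 4) (z : Fin 4 → ℝ) : z l - (∑ k, z k) / 4 = ∑ k, d l k * z k := by
    simp [d, sub_mul, Finset.sum_sub_distrib, ← Finset.mul_sum]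
    ring
  have hdd (l m : Fin 4) : ∑ k, d l k * d m k = (if l = m then 1 else 0) - 1 / 4 := by
    fin_cases l <;> fin_cases m <;> simp [d, Fin.sum_univ_four] <;> norm_num
  have hii := hdd i i
  have hjj := hdd j j
  have hji := hdd j i
  simp only [if_true, hij.symm, if_false] at hii hjj hji
  simp only [Fin.sum_univ_four] at hii hjj hji
  convert measurePreserving_gaussianReal_prod_of_orthonormal
    (fun k => s * (d j k + d i k / 3)) (fun k => t * d i k) ?_ ?_ ?_ using 2 with z
  · rw [hd, hd, Prod.mk.injEq]
    simp only [Fin.sum_univ_four]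
    constructor <;> ring
  · simp only [Fin.sum_univ_four]
    linear_combination s ^ 2 * (hjj + 2 / 3 * hji + hii / 9) + 2 / 3 * hs
  · simp only [Fin.sum_univ_four]
    linear_combination t ^ 2 * hii + 3 / 4 * ht
  · simp only [Fin.sum_univ_four]
    linear_combination s * t * (hji + hii / 3)

lemma measureReal_mean_lt (i : Fin 4) :
    (Measure.pi fun _ : Fin 4 => gaussianReal 0 1).real {z | (∑ k, z k) / 4 < z i} = 1 / 2 := by
  obtain ⟨j, hj⟩ := exists_ne i
  rw [← gaussianReal_prod_real_upper_half, measureReal_def, measureReal_def,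
    ← (measurePreserving_deviations hj.symm).measure_preimage
    (measurableSet_lt (by fun_prop) (by fun_prop)).nullMeasurableSet]
  congr 2
  ext z
  have : 0 < 2 / √3 := by positivity
  simp [this]

lemma ae_ne_mean (i : Fin 4) :
    ∀ᵐ z ∂(Measure.pi fun _ : Fin 4 => gaussianReal 0 1), z i ≠ (∑ k, z k) / 4 := by
  obtain ⟨j, hj⟩ := exists_ne i
  have h : ∀ᵐ p ∂((gaussianReal 0 1).prod (gaussianReal 0 1)), p.2 ≠ 0 := by
    rw [ae_iff]
    simpa [measureReal_eq_zero_iff] using gaussianReal_prod_real_axis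
  filter_upwards [(measurePreserving_deviations hj.symm).quasiMeasurePreserving.ae h] with z hz hc
  simp [hc] at hz

lemma measureReal_mean_lt_and_mean_lt {i j : Fin 4} (hij : i ≠ j) :
    (Measure.pi fun _ : Fin 4 => gaussianReal 0 1).real
      {z | (∑ k, z k) / 4 < z i ∧ (∑ k, z k) / 4 < z j}
      = (Real.pi / 2 - Real.arcsin (1 / 3)) / (2 * Real.pi) := by
  rw [← gaussianReal_prod_real_sector (Real.arcsin_nonneg.2 (by norm_num))
    (Real.arcsin_le_pi_div_two _), measureReal_def, measureReal_def,
    ← (measurePreserving_deviations hij).measure_preimage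
    (measurableSet_sector _).nullMeasurableSet]
  congr 2
  ext z
  have h3 : 0 < 2 / √3 := by positivity
  have hc : √(3 / 2) * Real.cos (Real.arcsin (1 / 3)) = 2 / √3 := by
    rw [Real.cos_arcsin, ← Real.sqrt_mul (by norm_num), eq_div_iff (by positivity),
      ← Real.sqrt_mul (by norm_num), Real.sqrt_eq_iff_eq_sq (by norm_num) (by norm_num)]
    norm_num
  simp only [Set.mem_ofPred_eq, Set.mem_preimage, mul_pos_iff_of_pos_left h3, sub_pos]
  refine and_congr_right fun _ => ?_
  rw [Real.sin_arcsin (by norm_num) (by norm_num), mul_right_comm (2 / √3),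
    mul_right_comm √(3 / 2), hc, mul_assoc, mul_lt_mul_iff_right₀ h3]
  constructor <;> intro h <;> linarith

theorem david_P42 (μ : Measure (Fin 4 → ℝ))
    (hμ : μ = Measure.pi fun _ : Fin 4 => gaussianReal 0 1) :
    μ {z | (Finset.univ.filter fun i => (∑ j, z j) / 4 < z i).card = 2}
      = ENNReal.ofReal (6 / Real.pi * Real.arcsin (1 / 3)) := by
  have hprob : IsProbabilityMeasure μ := hμ ▸ inferInstance
  let A (i : Fin 4) : Set (Fin 4 → ℝ) := {z | (∑ j, z j) / 4 < z i}
  have hA (i : Fin 4) : MeasurableSet (A i) := measurableSet_lt (by fun_prop) (by fun_prop)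
  set E : Set (Fin 4 → ℝ) :=
    {z | (Finset.univ.filter fun i => (∑ j, z j) / 4 < z i).card = 2}
  have hind (z : Fin 4 → ℝ) (i : Fin 4) :
      (A i).indicator (1 : (Fin 4 → ℝ) → ℝ) z = if (∑ j, z j) / 4 < z i then 1 else 0 := rfl
  have hE : MeasurableSet E := by
    have hm : Measurable fun z : Fin 4 → ℝ => ∑ i, (A i).indicator (1 : (Fin 4 → ℝ) → ℝ) z :=
      Finset.measurable_sum _ fun i _ => measurable_one.indicator (hA i)
    convert hm (measurableSet_singleton (2 : ℝ)) using 1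
    ext z
    simp only [E, Set.mem_ofPred_eq, Set.mem_preimage, Set.mem_singleton_iff, hind,
      Finset.sum_boole]
    norm_cast
  have hae : E.indicator (1 : (Fin 4 → ℝ) → ℝ) =ᵐ[μ] fun z =>
      3 * ∑ i, (A i).indicator 1 z - 3
        - ∑ p ∈ Finset.univ.offDiag, (A p.1 ∩ A p.2).indicator 1 z := by
    rw [hμ]
    filter_upwards [ae_ne_mean 0] with z hz
    have hoff : ∑ p ∈ (Finset.univ : Finset (Fin 4)).offDiag,
        (A p.1 ∩ A p.2).indicator (1 : (Fin 4 → ℝ) → ℝ) z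
        = (∑ i, (A i).indicator 1 z) * (∑ i, (A i).indicator 1 z)
          - ∑ i, (A i).indicator 1 z := by
      rw [Finset.sum_mul_sum, ← Finset.sum_product', ← Finset.diag_union_offDiag,
        Finset.sum_union (Finset.disjoint_diag_offDiag _), Finset.sum_diag]
      have hsq : ∑ i, (A i).indicator (1 : (Fin 4 → ℝ) → ℝ) z * (A i).indicator 1 z
          = ∑ i, (A i).indicator 1 z :=
        Finset.sum_congr rfl fun i _ => by rw [hind]; split_ifs <;> simp
      simp_rw [Set.inter_indicator_one, Pi.mul_apply]
      rw [hsq, add_sub_cancel_left]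
    rw [hoff]
    simp_rw [hind, Finset.sum_boole]
    set s := Finset.univ.filter fun i => (∑ j, z j) / 4 < z i with hs
    have hlt : s.card < 4 := by
      by_contra! hc
      have huniv : s = Finset.univ :=
        Finset.eq_univ_of_card s (le_antisymm (Finset.card_le_univ s) (by simpa using hc))
      have hall (i : Fin 4) : (∑ j, z j) / 4 < z i := by
        have : i ∈ s := huniv ▸ Finset.mem_univ i
        simpa [hs] using this
      have h0 := hall 0
      have h1 := hall 1
      have h2 := hall 2
      have h3 := hall 3
      rw [Fin.sum_univ_four] at h0 h1 h2 h3
      linarith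
    have hpos : 0 < s.card := by
      by_contra! hc
      have hempty : s = ∅ := Finset.card_eq_zero.1 (by omega)
      have hall (i : Fin 4) : z i ≤ (∑ j, z j) / 4 := by
        have : i ∉ s := by simp [hempty]
        simpa [hs] using this
      have h0 := lt_of_le_of_ne (hall 0) hz
      have h1 := hall 1
      have h2 := hall 2
      have h3 := hall 3
      rw [Fin.sum_univ_four] at h0 h1 h2 h3
      linarith
    have hEs : E.indicator (1 : (Fin 4 → ℝ) → ℝ) z = if s.card = 2 then 1 else 0 := by
      simp [Set.indicator_apply, E, hs]
    rw [hEs]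
    interval_cases s.card <;> norm_num
  have hint (B : Set (Fin 4 → ℝ)) (hB : MeasurableSet B) :
      Integrable (B.indicator (1 : (Fin 4 → ℝ) → ℝ)) μ := (integrable_const 1).indicator hB
  have hAi (i : Fin 4) : μ.real (A i) = 1 / 2 := hμ ▸ measureReal_mean_lt i
  have hAij : ∀ p ∈ (Finset.univ : Finset (Fin 4)).offDiag, μ.real (A p.1 ∩ A p.2)
      = (Real.pi / 2 - Real.arcsin (1 / 3)) / (2 * Real.pi) := fun p hp =>
    hμ ▸ measureReal_mean_lt_and_mean_lt (Finset.mem_offDiag.1 hp).2.2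
  have hreal : μ.real E = 6 / Real.pi * Real.arcsin (1 / 3) := by
    have hpi := Real.pi_ne_zero
    rw [← integral_indicator_one hE, integral_congr_ae hae, integral_sub, integral_sub,
      integral_const_mul, integral_finsetSum, integral_finsetSum]
    · simp_rw [integral_indicator_one (hA _), integral_indicator_one ((hA _).inter (hA _)), hAi]
      rw [Finset.sum_congr rfl hAij]
      simp
      field_simp
      ring
    · exact fun p _ => hint _ ((hA _).inter (hA _))
    · exact fun i _ => hint _ (hA _)
    · exact (integrable_finsetSum _ fun i _ => hint _ (hA _)).const_mul _
    · exact integrable_const _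
    · exact ((integrable_finsetSum _ fun i _ => hint _ (hA _)).const_mul _).sub
        (integrable_const _)
    · exact integrable_finsetSum _ fun p _ => hint _ ((hA _).inter (hA _))
  rw [← hreal, ofReal_measureReal]
end

section
/- For five i.i.d. standard Gaussian samples in ℝ, the probability that exactly two of them exceed the sample mean equals 1/4 + (5/(2π))·arcsin(1/4). -/
open MeasureTheory ProbabilityTheory

section LinearForms

variable {ι : Type*} [Fintype ι]

/-- The coordinates of a standard Gaussian vector are jointly Gaussian. -/
lemma hasGaussianLaw_eval_pi_gaussianReal :
    HasGaussianLaw (fun (z : ι → ℝ) i ↦ z i) (Measure.pi fun _ : ι ↦ gaussianReal 0 1) := by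
  refine iIndepFun.hasGaussianLaw (X := fun (i : ι) (z : ι → ℝ) ↦ z i) (fun i ↦ ?_)
    (iIndepFun_pi (X := fun _ ↦ id) fun _ ↦ aemeasurable_id)
  exact (measurePreserving_eval (fun _ : ι ↦ gaussianReal 0 1) i).hasLaw.hasGaussianLaw

lemma covariance_eval_pi_gaussianReal [DecidableEq ι] (i j : ι) :
    cov[fun z : ι → ℝ ↦ z i, fun z ↦ z j; Measure.pi fun _ : ι ↦ gaussianReal 0 1]
      = if i = j then 1 else 0 := by
  split_ifs with h
  · subst h
    have hp := measurePreserving_eval (fun _ : ι ↦ gaussianReal 0 1) i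
    rw [covariance_self (measurable_pi_apply i).aemeasurable]
    have := variance_map (X := id) (μ := Measure.pi fun _ : ι ↦ gaussianReal 0 1)
      (Y := Function.eval i) (by fun_prop) hp.aemeasurable
    rw [hp.map_eq, variance_id_gaussianReal] at this
    exact this.symm.trans (by simp)
  · exact ((iIndepFun_pi (μ := fun _ : ι ↦ gaussianReal 0 1) (X := fun _ ↦ id)
      fun _ ↦ aemeasurable_id).indepFun h).covariance_eq_zero
      (hasGaussianLaw_eval_pi_gaussianReal.eval i).memLp_two
      (hasGaussianLaw_eval_pi_gaussianReal.eval j).memLp_two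

lemma covariance_linear_pi_gaussianReal (a b : ι → ℝ) :
    cov[fun z : ι → ℝ ↦ ∑ k, a k * z k, fun z ↦ ∑ k, b k * z k;
      Measure.pi fun _ : ι ↦ gaussianReal 0 1] = ∑ k, a k * b k := by
  classical
  rw [covariance_fun_sum_fun_sum
    (fun i ↦ (hasGaussianLaw_eval_pi_gaussianReal.eval i).memLp_two.const_mul _)
    (fun i ↦ (hasGaussianLaw_eval_pi_gaussianReal.eval i).memLp_two.const_mul _)]
  simp [covariance_const_mul_left, covariance_const_mul_right, covariance_eval_pi_gaussianReal,
    mul_comm]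

lemma hasGaussianLaw_linear_prodMk (a b : ι → ℝ) :
    HasGaussianLaw (fun z : ι → ℝ ↦ (∑ k, a k * z k, ∑ k, b k * z k))
      (Measure.pi fun _ : ι ↦ gaussianReal 0 1) := by
  have h := (hasGaussianLaw_eval_pi_gaussianReal (ι := ι)).map_fun
    ((∑ k, a k • ContinuousLinearMap.proj (R := ℝ) (φ := fun _ : ι ↦ ℝ) k).prod
      (∑ k, b k • ContinuousLinearMap.proj (R := ℝ) (φ := fun _ : ι ↦ ℝ) k))
  simpa using h

/-- A linear form with unit coefficient vector maps the standard Gaussian vector to the standard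
Gaussian law. -/
lemma map_linear_pi_gaussianReal (a : ι → ℝ) (ha : ∑ k, a k * a k = 1) :
    (Measure.pi fun _ : ι ↦ gaussianReal 0 1).map (fun z ↦ ∑ k, a k * z k)
      = gaussianReal 0 1 := by
  have hmean (i : ι) : ∫ z : ι → ℝ, z i ∂(Measure.pi fun _ : ι ↦ gaussianReal 0 1) = 0 := by
    have hp := measurePreserving_eval (fun _ : ι ↦ gaussianReal 0 1) i
    have := integral_map (f := id) hp.aemeasurable (by fun_prop)
    rw [hp.map_eq] at this
    exact this.symm.trans (by simp)
  rw [(hasGaussianLaw_linear_prodMk a a).fst.map_eq_gaussianReal,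
    ← covariance_self (by fun_prop : Measurable _).aemeasurable, covariance_linear_pi_gaussianReal, ha,
    integral_finsetSum _ fun i _ ↦
      (hasGaussianLaw_eval_pi_gaussianReal.eval i).integrable.const_mul _]
  simp [integral_const_mul, hmean]

/-- Two orthonormal linear forms of a standard Gaussian vector are independent standard
Gaussians. -/
lemma map_linear_prodMk_pi_gaussianReal (a b : ι → ℝ) (ha : ∑ k, a k * a k = 1)
    (hb : ∑ k, b k * b k = 1) (hab : ∑ k, a k * b k = 0) :
    (Measure.pi fun _ : ι ↦ gaussianReal 0 1).map
      (fun z ↦ (∑ k, a k * z k, ∑ k, b k * z k)) = (gaussianReal 0 1).prod (gaussianReal 0 1) := by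
  have h := (hasGaussianLaw_linear_prodMk a b).indepFun_of_covariance_eq_zero
    (by rw [covariance_linear_pi_gaussianReal, hab])
  rw [(indepFun_iff_map_prod_eq_prod_map_map (by fun_prop : Measurable _).aemeasurable
    (by fun_prop : Measurable _).aemeasurable).1 h,
    map_linear_pi_gaussianReal a ha, map_linear_pi_gaussianReal b hb]

lemma measurePreserving_neg_pi_gaussianReal :
    MeasurePreserving (fun z : ι → ℝ ↦ -z) (Measure.pi fun _ : ι ↦ gaussianReal 0 1)
      (Measure.pi fun _ : ι ↦ gaussianReal 0 1) :=
  measurePreserving_pi _ _ (f := fun _ x ↦ -x)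
    fun _ ↦ ⟨measurable_neg, by simpa using gaussianReal_map_neg (μ := 0) (v := 1)⟩

end LinearForms

lemma lintegral_Ioi_mul_exp_neg_sq_div_two :
    ∫⁻ r in Set.Ioi (0 : ℝ), ENNReal.ofReal (r * Real.exp (-r ^ 2 / 2)) = 1 := by
  have hd (x : ℝ) : HasDerivAt (fun r ↦ -Real.exp (-r ^ 2 / 2)) (x * Real.exp (-x ^ 2 / 2)) x := by
    have h := (((hasDerivAt_pow 2 x).neg).div_const 2).exp.neg
    exact h.congr_deriv (by simp only [Pi.neg_apply]; push_cast; ring)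
  have hnn : ∀ x ∈ Set.Ioi (0 : ℝ), 0 ≤ x * Real.exp (-x ^ 2 / 2) := fun x hx ↦
    mul_nonneg (le_of_lt hx) (Real.exp_pos _).le
  have hlim : Filter.Tendsto (fun r : ℝ ↦ -Real.exp (-r ^ 2 / 2)) Filter.atTop (nhds 0) := by
    have h1 : Filter.Tendsto (fun r : ℝ ↦ r ^ 2 / 2) Filter.atTop Filter.atTop :=
      (Filter.tendsto_pow_atTop two_ne_zero).atTop_div_const two_pos
    simpa [neg_div, Function.comp_def] using
      (Real.tendsto_exp_neg_atTop_nhds_zero.comp h1).neg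
  rw [← ofReal_integral_eq_lintegral_ofReal
    (integrableOn_Ioi_deriv_of_nonneg' (fun x _ ↦ hd x) hnn hlim)
    ((ae_restrict_iff' measurableSet_Ioi).2 (.of_forall hnn)),
    integral_Ioi_of_hasDerivAt_of_nonneg' (fun x _ ↦ hd x) hnn hlim]
  simp

lemma polar_mem_halfPlane_wedge_iff (c : ℝ) {r θ : ℝ} (hr : 0 < r)
    (hθ : θ ∈ Set.Ioo (-Real.pi) Real.pi) :
    (0 < r * Real.cos θ ∧ r * Real.sin θ ≤ c * (r * Real.cos θ)) ↔
      θ ∈ Set.Ioc (-(Real.pi / 2)) (Real.arctan c) := by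
  rw [mul_left_comm c, mul_le_mul_iff_right₀ hr, mul_pos_iff_of_pos_left hr]
  have key (h1 : -(Real.pi / 2) < θ) (h2 : θ < Real.pi / 2) :
      Real.sin θ ≤ c * Real.cos θ ↔ θ ≤ Real.arctan c := by
    have hc := Real.cos_pos_of_mem_Ioo ⟨h1, h2⟩
    rw [← div_le_iff₀ hc, ← Real.tan_eq_sin_div_cos, ← Real.arctan_le_arctan_iff,
      Real.arctan_tan h1 h2]
  constructor
  · rintro ⟨hc, hs⟩
    have h1 : -(Real.pi / 2) < θ := by
      by_contra! h
      have := Real.cos_nonpos_of_pi_div_two_le_of_le (x := -θ) (by linarith)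
        (by linarith [hθ.1, Real.pi_pos])
      rw [Real.cos_neg] at this
      linarith
    have h2 : θ < Real.pi / 2 := by
      by_contra! h
      have := Real.cos_nonpos_of_pi_div_two_le_of_le h (by linarith [hθ.2, Real.pi_pos])
      linarith
    exact ⟨h1, (key h1 h2).1 hs⟩
  · rintro ⟨h1, h2⟩
    have h3 := h2.trans_lt (Real.arctan_lt_pi_div_two c)
    exact ⟨Real.cos_pos_of_mem_Ioo ⟨h1, h3⟩, (key h1 h3).2 h2⟩

lemma gaussianPDF_mul_gaussianPDF_polar (r θ : ℝ) (hr : 0 < r) :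
    ENNReal.ofReal r * (gaussianPDF 0 1 (r * Real.cos θ) * gaussianPDF 0 1 (r * Real.sin θ)) =
      ENNReal.ofReal (r * Real.exp (-r ^ 2 / 2)) * ENNReal.ofReal (1 / (2 * Real.pi)) := by
  have h2 : Real.exp (-r ^ 2 / 2)
      = Real.exp (-(r * Real.cos θ) ^ 2 / 2) * Real.exp (-(r * Real.sin θ) ^ 2 / 2) := by
    rw [← Real.exp_add]
    congr 1
    linear_combination (r ^ 2 / 2) * (Real.sin_sq_add_cos_sq θ)
  have h3 : (√(2 * Real.pi))⁻¹ * (√(2 * Real.pi))⁻¹ = 1 / (2 * Real.pi) := by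
    rw [← mul_inv, Real.mul_self_sqrt (by positivity), one_div]
  simp only [gaussianPDF, gaussianPDFReal, sub_zero, NNReal.coe_one, mul_one]
  rw [← ENNReal.ofReal_mul (by positivity), ← ENNReal.ofReal_mul hr.le,
    ← ENNReal.ofReal_mul (by positivity), h2, ← h3]
  congr 1
  ring

lemma measurableSet_wedge (c : ℝ) : MeasurableSet {p : ℝ × ℝ | 0 < p.1 ∧ p.2 ≤ c * p.1} :=
  (measurableSet_lt measurable_const measurable_fst).inter
    (measurableSet_le measurable_snd (measurable_fst.const_mul c))

/-- The probability that a standard Gaussian vector of the plane lies in the wedge bounded by the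
lower half of the vertical axis and the ray of slope `c`. -/
lemma prod_gaussianReal_wedge (c : ℝ) :
    ((gaussianReal 0 1).prod (gaussianReal 0 1)) {p : ℝ × ℝ | 0 < p.1 ∧ p.2 ≤ c * p.1}
      = ENNReal.ofReal ((Real.pi / 2 + Real.arctan c) / (2 * Real.pi)) := by
  have hS := measurableSet_wedge c
  have hsub : Set.Ioc (-(Real.pi / 2)) (Real.arctan c) ∩ Set.Ioo (-Real.pi) Real.pi
      = Set.Ioc (-(Real.pi / 2)) (Real.arctan c) := by
    refine Set.inter_eq_left.2 fun θ h ↦ ⟨?_, ?_⟩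
    · linarith [h.1, Real.pi_pos]
    · linarith [h.2, Real.pi_pos, Real.arctan_lt_pi_div_two c]
  rw [gaussianReal_of_var_ne_zero 0 one_ne_zero,
    prod_withDensity (measurable_gaussianPDF 0 1) (measurable_gaussianPDF 0 1),
    withDensity_apply _ hS, ← Measure.volume_eq_prod, ← lintegral_indicator hS,
    ← lintegral_comp_polarCoord_symm]
  calc
    _ = ∫⁻ p in Set.Ioi (0 : ℝ) ×ˢ Set.Ioo (-Real.pi) Real.pi,
        ENNReal.ofReal (p.1 * Real.exp (-p.1 ^ 2 / 2)) *
          (Set.Ioc (-(Real.pi / 2)) (Real.arctan c)).indicator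
            (fun _ ↦ ENNReal.ofReal (1 / (2 * Real.pi))) p.2 := by
      refine setLIntegral_congr_fun (measurableSet_Ioi.prod measurableSet_Ioo) fun p hp ↦ ?_
      obtain ⟨r, θ⟩ := p
      have hr : 0 < r := hp.1
      have hm := polar_mem_halfPlane_wedge_iff c hr hp.2
      simp only [polarCoord_symm_apply, Set.indicator_apply, Set.mem_ofPred_eq, smul_eq_mul, hm]
      split_ifs
      · exact gaussianPDF_mul_gaussianPDF_polar r θ hr
      · simp
    _ = _ := by
      rw [Measure.volume_eq_prod, ← Measure.prod_restrict,
        lintegral_prod_mul (f := fun r ↦ ENNReal.ofReal (r * Real.exp (-r ^ 2 / 2)))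
          (by fun_prop) (measurable_const.indicator measurableSet_Ioc).aemeasurable,
        lintegral_Ioi_mul_exp_neg_sq_div_two, one_mul,
        lintegral_indicator measurableSet_Ioc, Measure.restrict_restrict measurableSet_Ioc, hsub,
        lintegral_const, Measure.restrict_apply_univ, Real.volume_Ioc,
        ← ENNReal.ofReal_mul (by positivity)]
      congr 1
      ring

section Deviations

variable {ι : Type*} [Fintype ι]

lemma card_filter_lt_mul_card_filter_le (m : ℝ) (z : ι → ℝ) :
    (((Finset.univ.filter fun i ↦ m < z i).card * (Finset.univ.filter fun i ↦ z i ≤ m).card : ℕ)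
      : ENNReal) = ∑ i, ∑ j, if m < z i ∧ z j ≤ m then 1 else 0 := by
  simp_rw [ite_and, Finset.card_filter, Finset.sum_mul_sum]
  push_cast
  refine Finset.sum_congr rfl fun i _ ↦ Finset.sum_congr rfl fun j _ ↦ ?_
  split_ifs <;> simp

end Deviations

lemma arctan_inv_sqrt_fifteen : Real.arctan (1 / √15) = Real.arcsin (1 / 4) := by
  rw [Real.arcsin_eq_arctan (by norm_num [Set.mem_Ioo])]
  congr 1
  have h : √(1 - (1 / 4 : ℝ) ^ 2) = √15 / 4 := by
    rw [show (1 - (1 / 4 : ℝ) ^ 2) = 15 / 4 ^ 2 by norm_num, Real.sqrt_div (by norm_num),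
      Real.sqrt_sq (by norm_num)]
  rw [h]
  field_simp

/-- The coefficients of the standardized deviation `(√5 / 2) * (z i - mean z)`. -/
noncomputable def deviation (i k : Fin 5) : ℝ := √5 / 2 * ((if k = i then 1 else 0) - 1 / 5)

lemma sum_deviation_mul (i : Fin 5) (z : Fin 5 → ℝ) :
    ∑ k, deviation i k * z k = √5 / 2 * (z i - (∑ k, z k) / 5) := by
  simp only [deviation, mul_assoc, sub_mul, ← Finset.mul_sum, Finset.sum_sub_distrib, ite_mul,
    one_mul, zero_mul, Finset.sum_ite_eq', Finset.mem_univ, if_true]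
  ring

lemma sum_deviation_mul_self (i : Fin 5) : ∑ k, deviation i k * deviation i k = 1 := by
  have h5 : √5 * √5 = 5 := Real.mul_self_sqrt (by norm_num)
  have h0 : ∑ k, deviation i k = 0 := by simpa using sum_deviation_mul i 1
  rw [sum_deviation_mul, h0, deviation, if_pos rfl]
  linear_combination h5 / 5

/-- For five independent standard Gaussians, the probability that one given variable exceeds the
sample mean while another given one does not. -/
lemma pi_gaussianReal_mean_lt_and_le_mean {i j : Fin 5} (hij : i ≠ j) :
    (Measure.pi fun _ : Fin 5 ↦ gaussianReal 0 1)
        {z | (∑ k, z k) / 5 < z i ∧ z j ≤ (∑ k, z k) / 5}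
      = ENNReal.ofReal ((Real.pi / 2 + Real.arcsin (1 / 4)) / (2 * Real.pi)) := by
  have h3 : √3 * √3 = 3 := Real.mul_self_sqrt (by norm_num)
  have h15 : √15 = √3 * √5 := by rw [← Real.sqrt_mul (by norm_num)]; norm_num
  set b : Fin 5 → ℝ := fun k ↦
    2 / √3 * ((if k = j then 1 else 0) + (if k = i then 1 else 0) / 4 - 1 / 4) with hb
  have hLa := sum_deviation_mul i
  have hLb (z : Fin 5 → ℝ) : ∑ k, b k * z k
      = 2 / √3 * (z j + z i / 4 - (∑ k, z k) / 4) := by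
    simp only [hb, mul_assoc, sub_mul, add_mul, ← Finset.mul_sum, Finset.sum_sub_distrib,
      Finset.sum_add_distrib, ite_mul, one_mul, zero_mul, Finset.sum_ite_eq', Finset.mem_univ,
      if_true, ite_div, zero_div]
    ring
  have hsb : ∑ k, b k = 0 := by
    have := hLb 1
    norm_num at this
    exact this
  have hbb : ∑ k, b k * b k = 1 := by
    rw [hLb, hsb]
    simp only [hb, if_true, if_neg hij, if_neg hij.symm]
    field_simp
    linear_combination -16 * h3
  have hab : ∑ k, deviation i k * b k = 0 := by
    rw [hLa, hsb]
    simp only [hb, if_true, if_neg hij]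
    ring
  rw [← arctan_inv_sqrt_fifteen, ← prod_gaussianReal_wedge,
    ← map_linear_prodMk_pi_gaussianReal (deviation i) b (sum_deviation_mul_self i) hbb hab,
    Measure.map_apply (by fun_prop) (measurableSet_wedge _)]
  congr 1
  ext z
  simp only [Set.mem_ofPred_eq, Set.mem_preimage, hLa, hLb]
  refine and_congr ?_ ?_
  · rw [mul_pos_iff_of_pos_left (by positivity), sub_pos]
  · rw [h15, show 1 / (√3 * √5) * (√5 / 2 * (z i - (∑ k, z k) / 5))
      = 2 / √3 * ((z i - (∑ k, z k) / 5) / 4) by field_simp; ring,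
      mul_le_mul_iff_right₀ (by positivity)]
    constructor <;> intro h <;> linarith

lemma ae_ne_mean_pi_gaussianReal (i : Fin 5) :
    ∀ᵐ z ∂(Measure.pi fun _ : Fin 5 ↦ gaussianReal 0 1), z i ≠ (∑ k, z k) / 5 := by
  have hLa := sum_deviation_mul i
  have := nullSingletonClass_gaussianReal (μ := 0) (v := 1) one_ne_zero
  have h0 : ∀ᵐ x ∂(gaussianReal 0 1), x ≠ 0 := by
    simp [ae_iff]
  rw [← map_linear_pi_gaussianReal (deviation i) (sum_deviation_mul_self i)] at h0
  filter_upwards [ae_of_ae_map (by fun_prop : Measurable _).aemeasurable h0] with z hz h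
  exact hz (by rw [hLa, h]; simp)

/-- When no sample equals the mean, the number `n` of samples above it satisfies
`n * (5 - n) = 4 + 2 * 𝟙(n = 2) + 2 * 𝟙(n = 3)`. -/
lemma two_mul_indicator_add_eq_sum {z : Fin 5 → ℝ} (hz : ∀ i, z i ≠ (∑ k, z k) / 5) :
    2 * {z : Fin 5 → ℝ | (Finset.univ.filter fun i ↦ (∑ j, z j) / 5 < z i).card = 2}.indicator
        (1 : (Fin 5 → ℝ) → ENNReal) z
      + 2 * {z : Fin 5 → ℝ | (Finset.univ.filter fun i ↦ (∑ j, z j) / 5 < z i).card = 2}.indicator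
        (1 : (Fin 5 → ℝ) → ENNReal) (-z) + 4
      = ∑ i, ∑ j, {z : Fin 5 → ℝ | (∑ k, z k) / 5 < z i ∧ z j ≤ (∑ k, z k) / 5}.indicator
        (1 : (Fin 5 → ℝ) → ENNReal) z := by
  have hneg : (Finset.univ.filter fun i ↦ (∑ j, (-z) j) / 5 < (-z) i)
      = Finset.univ.filter fun i ↦ z i ≤ (∑ k, z k) / 5 := by
    ext i
    simp only [Finset.mem_filter, Finset.mem_univ, true_and, Pi.neg_apply, Finset.sum_neg_distrib,
      neg_div, neg_lt_neg_iff]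
    exact ⟨le_of_lt, fun h ↦ lt_of_le_of_ne h (hz i)⟩
  simp only [Set.indicator_apply, Set.mem_ofPred_eq, hneg, Pi.one_apply]
  rw [← card_filter_lt_mul_card_filter_le]
  have hadd : (Finset.univ.filter fun i ↦ (∑ k, z k) / 5 < z i).card
      + (Finset.univ.filter fun i ↦ z i ≤ (∑ k, z k) / 5).card = 5 := by
    simpa using Finset.card_filter_add_card_filter_not (s := Finset.univ)
      (fun i ↦ (∑ k, z k) / 5 < z i)
  have hpos : 0 < (Finset.univ.filter fun i ↦ (∑ k, z k) / 5 < z i).card := by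
    obtain ⟨i, -, hi⟩ := Finset.exists_le_of_sum_le (s := Finset.univ) (f := fun _ ↦ (∑ k, z k) / 5)
      (g := z) Finset.univ_nonempty (by simp; linarith)
    exact Finset.card_pos.2 ⟨i, by simpa using lt_of_le_of_ne hi (hz i).symm⟩
  have hpos' : 0 < (Finset.univ.filter fun i ↦ z i ≤ (∑ k, z k) / 5).card := by
    obtain ⟨i, -, hi⟩ := Finset.exists_le_of_sum_le (s := Finset.univ) (f := z)
      (g := fun _ ↦ (∑ k, z k) / 5) Finset.univ_nonempty (by simp; linarith)
    exact Finset.card_pos.2 ⟨i, by simpa using hi⟩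
  generalize (Finset.univ.filter fun i ↦ (∑ k, z k) / 5 < z i).card = n at *
  generalize (Finset.univ.filter fun i ↦ z i ≤ (∑ k, z k) / 5).card = m at *
  obtain rfl : m = 5 - n := by omega
  have : n ≤ 4 := by omega
  interval_cases n <;> norm_num

lemma measurableSet_card_filter_mean_lt_eq (n : ℕ) : MeasurableSet
    {z : Fin 5 → ℝ | (Finset.univ.filter fun i ↦ (∑ j, z j) / 5 < z i).card = n} := by
  simp only [Finset.card_filter]
  have h : Measurable fun z : Fin 5 → ℝ ↦ ∑ i, if (∑ j, z j) / 5 < z i then 1 else 0 :=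
    Finset.measurable_fun_sum _ fun i _ ↦ Measurable.ite
      (measurableSet_lt (by fun_prop) (by fun_prop)) measurable_const measurable_const
  exact h (measurableSet_singleton n)

theorem david_P52 (μ : Measure (Fin 5 → ℝ))
    (hμ : μ = Measure.pi fun _ : Fin 5 => gaussianReal 0 1) :
    μ {z | (Finset.univ.filter fun i => (∑ j, z j) / 5 < z i).card = 2}
      = ENNReal.ofReal (1 / 4 + 5 / (2 * Real.pi) * Real.arcsin (1 / 4)) := by
  have hA := measurableSet_card_filter_mean_lt_eq 2
  have hS (i j : Fin 5) :
      MeasurableSet {z : Fin 5 → ℝ | (∑ k, z k) / 5 < z i ∧ z j ≤ (∑ k, z k) / 5} :=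
    (measurableSet_lt (f := fun z : Fin 5 → ℝ ↦ (∑ k, z k) / 5) (g := fun z ↦ z i)
      (by fun_prop) (by fun_prop)).inter
      (measurableSet_le (f := fun z : Fin 5 → ℝ ↦ z j) (g := fun z ↦ (∑ k, z k) / 5)
        (by fun_prop) (by fun_prop))
  have hprob : IsProbabilityMeasure μ := by rw [hμ]; infer_instance
  have hneg : MeasurePreserving (fun z : Fin 5 → ℝ ↦ -z) μ μ := by
    rw [hμ]; exact measurePreserving_neg_pi_gaussianReal
  have hμS (i j : Fin 5) : μ {z | (∑ k, z k) / 5 < z i ∧ z j ≤ (∑ k, z k) / 5}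
      = if i = j then 0
        else ENNReal.ofReal ((Real.pi / 2 + Real.arcsin (1 / 4)) / (2 * Real.pi)) := by
    split_ifs with h
    · subst h
      convert measure_empty (μ := μ)
      ext z
      simp
    · rw [hμ]; exact pi_gaussianReal_mean_lt_and_le_mean h
  have hae : ∀ᵐ z ∂μ, ∀ i, z i ≠ (∑ k, z k) / 5 := by
    rw [hμ]; exact ae_all_iff.2 ae_ne_mean_pi_gaussianReal
  have hm : Measurable ({z : Fin 5 → ℝ |
      (Finset.univ.filter fun i ↦ (∑ j, z j) / 5 < z i).card = 2}.indicator
        (1 : (Fin 5 → ℝ) → ENNReal)) := measurable_one.indicator hA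
  have hm' := hm.comp (measurable_neg (G := Fin 5 → ℝ))
  simp only [Function.comp_def] at hm'
  have key := lintegral_congr_ae (hae.mono fun z hz ↦ two_mul_indicator_add_eq_sum hz)
  rw [lintegral_add_right _ measurable_const,
    lintegral_add_left (hm.const_mul 2), lintegral_const_mul _ hm,
    lintegral_const_mul _ hm', hneg.lintegral_comp hm,
    lintegral_indicator_one hA, lintegral_const, measure_univ,
    lintegral_finsetSum _ fun i _ ↦ Finset.measurable_fun_sum _ fun j _ ↦
      measurable_one.indicator (hS i j)] at key
  simp_rw [lintegral_finsetSum _ fun j _ ↦ measurable_one.indicator (hS _ j),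
    lintegral_indicator_one (hS _ _), hμS] at key
  have harc : 0 ≤ Real.arcsin (1 / 4) := Real.arcsin_nonneg.2 (by norm_num)
  have hq : 0 ≤ (Real.pi / 2 + Real.arcsin (1 / 4)) / (2 * Real.pi) := by positivity
  have hsum (q : ENNReal) : ∑ i : Fin 5, ∑ j : Fin 5, (if i = j then 0 else q) = 20 * q := by
    simp [Fin.sum_univ_five]
    ring
  rw [hsum, ← ENNReal.ofReal_toReal (measure_ne_top μ _)] at key
  rw [← ENNReal.ofReal_toReal (measure_ne_top μ _)]
  congr 1
  have key' := congrArg ENNReal.toReal key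
  rw [mul_one, ENNReal.toReal_add (by finiteness) (by finiteness),
    ENNReal.toReal_add (by finiteness) (by finiteness), ENNReal.toReal_mul, ENNReal.toReal_mul,
    ENNReal.toReal_ofReal hq, ENNReal.toReal_ofReal ENNReal.toReal_nonneg] at key'
  norm_num at key'
  have hpi := Real.pi_pos
  field_simp at key' ⊢
  linarith
end

section
/- Four i.i.d. standard Gaussian points in ℝ² are in convex position with probability (6/π)·arcsin(1/3). -/
open MeasureTheory ProbabilityTheory

/-- The cross product of two vectors of the Euclidean plane. -/
noncomputable def planeCross (u v : EuclideanSpace ℝ (Fin 2)) : ℝ := u 0 * v 1 - u 1 * v 0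

lemma planeCross_eq_inner (u v : EuclideanSpace ℝ (Fin 2)) :
    planeCross u v = inner ℝ (!₂[v 1, -v 0] : EuclideanSpace ℝ (Fin 2)) u := by
  simp [planeCross, PiLp.inner_apply, Fin.sum_univ_two]
  ring

/-- Twice the signed area of the triangle `a b c`. -/
noncomputable def signedArea (a b c : EuclideanSpace ℝ (Fin 2)) : ℝ := planeCross (b - a) (c - a)

lemma mem_convexHull_triple_iff {a b c z : EuclideanSpace ℝ (Fin 2)}
    (ha : signedArea z b c ≠ 0) (hb : signedArea a z c ≠ 0) (hc : signedArea a b z ≠ 0) :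
    z ∈ convexHull ℝ {a, b, c} ↔
      0 < signedArea z b c * signedArea a z c ∧ 0 < signedArea z b c * signedArea a b z ∧
        0 < signedArea a z c * signedArea a b z := by
  have key : z ∈ convexHull ℝ {a, b, c} ↔
      ∃ w₁ w₂ w₃ : ℝ, 0 ≤ w₁ ∧ 0 ≤ w₂ ∧ 0 ≤ w₃ ∧ w₁ + w₂ + w₃ = 1 ∧
        w₁ • a + w₂ • b + w₃ • c = z := by
    constructor
    · intro h
      rw [convexHull_insert (Set.insert_nonempty _ _), convexHull_pair, mem_convexJoin] at h
      obtain ⟨_, rfl, y, ⟨s, t, hs, ht, hst, rfl⟩, u, v, hu, hv, huv, rfl⟩ := h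
      refine ⟨u, v * s, v * t, hu, by positivity, by positivity, ?_, ?_⟩
      · rw [add_assoc, ← mul_add, hst, mul_one, huv]
      · module
    · rintro ⟨w₁, w₂, w₃, h₁, h₂, h₃, hw, rfl⟩
      have := (convex_convexHull ℝ {a, b, c}).sum_mem (t := Finset.univ) (w := ![w₁, w₂, w₃])
        (z := ![a, b, c])
        (by intro i _; fin_cases i <;> simp [h₁, h₂, h₃]) (by simpa [Fin.sum_univ_three] using hw)
        (by intro i _; fin_cases i <;> apply subset_convexHull <;> simp)
      simpa [Fin.sum_univ_three] using this
  have hsum : signedArea z b c + signedArea a z c + signedArea a b z = signedArea a b c := by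
    simp [signedArea, planeCross]; ring
  rw [key]
  constructor
  · rintro ⟨w₁, w₂, w₃, h₁, h₂, h₃, hw, rfl⟩
    obtain rfl : w₁ = 1 - w₂ - w₃ := by linarith
    have e₁ : signedArea ((1 - w₂ - w₃) • a + w₂ • b + w₃ • c) b c
        = (1 - w₂ - w₃) * signedArea a b c := by
      simp [signedArea, planeCross]; ring
    have e₂ : signedArea a ((1 - w₂ - w₃) • a + w₂ • b + w₃ • c) c = w₂ * signedArea a b c := by
      simp [signedArea, planeCross]; ring
    have e₃ : signedArea a b ((1 - w₂ - w₃) • a + w₂ • b + w₃ • c) = w₃ * signedArea a b c := by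
      simp [signedArea, planeCross]; ring
    rw [e₁] at ha
    rw [e₂] at hb
    rw [e₃] at hc
    rw [e₁, e₂, e₃]
    have prod_pos : ∀ {s t d : ℝ}, 0 ≤ s → 0 ≤ t → s * d ≠ 0 → t * d ≠ 0 →
        0 < (s * d) * (t * d) := by
      intro s t d hs ht hsd htd
      refine lt_of_le_of_ne ?_ (mul_ne_zero hsd htd).symm
      nlinarith [mul_nonneg (mul_nonneg hs ht) (sq_nonneg d)]
    exact ⟨prod_pos h₁ h₂ ha hb, prod_pos h₁ h₃ ha hc, prod_pos h₂ h₃ hb hc⟩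
  · rintro ⟨h₁₂, h₁₃, h₂₃⟩
    have hd : signedArea a b c ≠ 0 := by
      intro h
      rw [h] at hsum
      nlinarith [mul_self_nonneg (signedArea z b c), congrArg (signedArea z b c * ·) hsum]
    have hpos : ∀ {s t u : ℝ}, s + t + u = signedArea a b c → 0 < s * t → 0 < s * u →
        0 ≤ s / signedArea a b c := by
      intro s t u h hst hsu
      have : s / signedArea a b c = s * (s + t + u) / signedArea a b c ^ 2 := by
        rw [h]; field_simp
      rw [this]
      apply div_nonneg _ (sq_nonneg _)
      nlinarith [mul_self_nonneg s]
    have h₁ := hpos hsum h₁₂ h₁₃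
    have h₂ := hpos (s := signedArea a z c) (t := signedArea z b c) (u := signedArea a b z)
      (by linarith) (by linarith) h₂₃
    have h₃ := hpos (s := signedArea a b z) (t := signedArea z b c) (u := signedArea a z c)
      (by linarith) (by linarith) (by linarith)
    refine ⟨_, _, _, h₁, h₂, h₃, ?_, ?_⟩
    · rw [← add_div, ← add_div, hsum, div_self hd]
    · ext i
      fin_cases i
      · simp
        field_simp
        simp [signedArea, planeCross]; ring
      · simp
        field_simp
        simp [signedArea, planeCross]; ring

lemma map_rotation_prod :
    (Measure.pi fun _ : Fin 4 => stdGaussian (EuclideanSpace ℝ (Fin 2))).map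
      (fun x => ((√2)⁻¹ • (x 3 - x 2), (2 : ℝ)⁻¹ • (x 0 + x 1 - x 2 - x 3),
        (√2)⁻¹ • (x 0 - x 1))) =
    (stdGaussian (EuclideanSpace ℝ (Fin 2))).prod
      ((stdGaussian (EuclideanSpace ℝ (Fin 2))).prod (stdGaussian (EuclideanSpace ℝ (Fin 2)))) := by
  let pr (i : Fin 4) : (Fin 4 → EuclideanSpace ℝ (Fin 2)) →L[ℝ] EuclideanSpace ℝ (Fin 2) :=
    ContinuousLinearMap.proj i
  let M := ((√2)⁻¹ • (pr 3 - pr 2)).prod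
    (((2 : ℝ)⁻¹ • (pr 0 + pr 1 - pr 2 - pr 3)).prod ((√2)⁻¹ • (pr 0 - pr 1)))
  change Measure.map M _ = _
  apply Measure.ext_of_charFunDual
  ext L
  rw [charFunDual_map, charFunDual_pi, charFunDual_prod, charFunDual_prod]
  simp_rw [charFunDual_stdGaussian]
  rw [← Complex.exp_sum, ← Complex.exp_add, ← Complex.exp_add]
  congr 1
  have hs : (√2)⁻¹ ^ 2 = (2 : ℝ)⁻¹ := by rw [inv_pow, Real.sq_sqrt (by norm_num)]
  norm_cast
  simp_rw [(EuclideanSpace.basisFun (Fin 2) ℝ).norm_dual]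
  have h₀ (v : EuclideanSpace ℝ (Fin 2)) :
      L (M (Pi.single 0 v)) = 2⁻¹ * L (0, v, 0) + (√2)⁻¹ * L (0, 0, v) := by
    rw [← smul_eq_mul, ← smul_eq_mul, ← map_smul, ← map_smul, ← map_add]
    simp [M, pr]
  have h₁ (v : EuclideanSpace ℝ (Fin 2)) :
      L (M (Pi.single 1 v)) = 2⁻¹ * L (0, v, 0) - (√2)⁻¹ * L (0, 0, v) := by
    rw [← smul_eq_mul, ← smul_eq_mul, ← map_smul, ← map_smul, ← map_sub]
    simp [M, pr]
  have h₂ (v : EuclideanSpace ℝ (Fin 2)) :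
      L (M (Pi.single 2 v)) = -((√2)⁻¹ * L (v, 0, 0) + 2⁻¹ * L (0, v, 0)) := by
    rw [← smul_eq_mul, ← smul_eq_mul, ← map_smul, ← map_smul, ← map_add, ← map_neg]
    simp [M, pr]
  have h₃ (v : EuclideanSpace ℝ (Fin 2)) :
      L (M (Pi.single 3 v)) = (√2)⁻¹ * L (v, 0, 0) - 2⁻¹ * L (0, v, 0) := by
    rw [← smul_eq_mul, ← smul_eq_mul, ← map_smul, ← map_smul, ← map_sub]
    simp [M, pr]
  simp only [Fin.sum_univ_four, Fin.sum_univ_two, ContinuousLinearMap.comp_apply,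
    ContinuousLinearMap.single_apply, ContinuousLinearMap.inl_apply, ContinuousLinearMap.inr_apply,
    EuclideanSpace.basisFun_apply, ← Prod.mk_zero_zero, h₀, h₁, h₂, h₃]
  ring_nf
  rw [hs]
  ring

lemma stdGaussian_map_of_norm_eq_one {L : StrongDual ℝ (EuclideanSpace ℝ (Fin 2))} (hL : ‖L‖ = 1) :
    (stdGaussian (EuclideanSpace ℝ (Fin 2))).map L = gaussianReal 0 1 := by
  rw [IsGaussian.map_eq_gaussianReal, integral_strongDual_stdGaussian, variance_dual_stdGaussian,
    hL]
  simp

lemma integral_abs_mul_exp_neg_mul_sq {b : ℝ} (hb : 0 < b) :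
    ∫ x : ℝ, |x| * Real.exp (-b * x ^ 2) = b⁻¹ := by
  have h := integral_comp_abs (f := fun x => x * Real.exp (-b * x ^ 2))
  simp only [sq_abs] at h
  rw [h]
  have := integral_rpow_mul_exp_neg_mul_rpow (p := 2) (q := 1) (b := b)
    (by norm_num) (by norm_num) hb
  norm_num [Real.rpow_neg_one] at this
  simp only [neg_mul]
  rw [this]; ring

lemma lintegral_cauchy (u : ℝ) :
    ∫⁻ s, gaussianPDF 0 (1 / NNReal.mk (s ^ 2) (sq_nonneg s)) u ∂(gaussianReal 0 1) =
      ENNReal.ofReal (Real.pi⁻¹ * (1 + u ^ 2)⁻¹) := by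
  have hb : 0 < (1 + u ^ 2) / 2 := by positivity
  have hint := integral_abs_mul_exp_neg_mul_sq hb
  rw [gaussianReal_of_var_ne_zero _ one_ne_zero,
    lintegral_withDensity_eq_lintegral_mul₀ (by fun_prop) (by fun_prop)]
  have hae : ∀ᵐ s : ℝ,
      (gaussianPDF 0 1 * fun s => gaussianPDF 0 (1 / NNReal.mk (s ^ 2) (sq_nonneg s)) u) s
      = ENNReal.ofReal ((2 * Real.pi)⁻¹ * (|s| * Real.exp (-((1 + u ^ 2) / 2) * s ^ 2))) := by
    filter_upwards [Measure.ae_ne volume (0 : ℝ)] with s hs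
    rw [Pi.mul_apply, gaussianPDF, gaussianPDF, ← ENNReal.ofReal_mul (gaussianPDFReal_nonneg _ _ _)]
    congr 1
    have hs' : |s| ≠ 0 := abs_ne_zero.2 hs
    have hsqrt : √(2 * Real.pi * (s ^ 2)⁻¹) = √(2 * Real.pi) / |s| := by
      rw [← div_eq_mul_inv, Real.sqrt_div (by positivity), Real.sqrt_sq_eq_abs]
    simp only [gaussianPDFReal, NNReal.coe_one, mul_one, sub_zero, one_div, NNReal.coe_inv,
      NNReal.coe_mk, hsqrt]
    have hpi : √(2 * Real.pi) * √(2 * Real.pi) = 2 * Real.pi := Real.mul_self_sqrt (by positivity)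
    rw [show -((1 + u ^ 2) / 2) * s ^ 2 = -s ^ 2 / 2 + -u ^ 2 / (2 * (s ^ 2)⁻¹) by field_simp; ring,
      Real.exp_add, show (2 * Real.pi)⁻¹ = (√(2 * Real.pi))⁻¹ * (√(2 * Real.pi))⁻¹ by
        rw [← mul_inv, hpi]]
    field_simp
  rw [lintegral_congr_ae hae, ← ofReal_integral_eq_lintegral_ofReal, integral_const_mul, hint]
  · congr 1
    field_simp
  · apply Integrable.const_mul
    exact Integrable.of_integral_ne_zero (by rw [hint]; positivity)
  · exact .of_forall fun s => by positivity

lemma arctan_sqrt_two : 2 * Real.arctan (√2) = Real.pi / 2 + Real.arcsin (1 / 3) := by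
  have h₁ : Real.cos (2 * Real.arctan (√2)) = -(1 / 3) := by
    rw [Real.cos_two_mul, Real.cos_sq_arctan, Real.sq_sqrt (by norm_num)]
    norm_num
  have h₂ : Real.arccos (Real.cos (2 * Real.arctan (√2))) = 2 * Real.arctan (√2) :=
    Real.arccos_cos (by have := Real.arctan_nonneg.2 (Real.sqrt_nonneg 2); positivity)
      (by linarith [Real.arctan_lt_pi_div_two (√2)])
  rw [← h₂, h₁, Real.arccos_neg, Real.arccos]
  ring

lemma gaussian_prod_ratio {B : Set ℝ} (hB : MeasurableSet B) :
    ((gaussianReal 0 1).prod (gaussianReal 0 1)) {z | z.2 / z.1 ∈ B} =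
      ∫⁻ u in B, ENNReal.ofReal (Real.pi⁻¹ * (1 + u ^ 2)⁻¹) := by
  have hmeas : Measurable fun p : ℝ × ℝ =>
      gaussianPDF 0 (1 / NNReal.mk (p.1 ^ 2) (sq_nonneg p.1)) p.2 := by fun_prop
  have : NullSingletonClass (gaussianReal 0 1) := nullSingletonClass_gaussianReal one_ne_zero
  have hS : MeasurableSet {z : ℝ × ℝ | z.2 / z.1 ∈ B} :=
    (measurable_snd.div measurable_fst) hB
  rw [Measure.prod_apply hS]
  have hae : ∀ᵐ s ∂(gaussianReal 0 1),
      gaussianReal 0 1 (Prod.mk s ⁻¹' {z : ℝ × ℝ | z.2 / z.1 ∈ B}) =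
        ∫⁻ u in B, gaussianPDF 0 (1 / NNReal.mk (s ^ 2) (sq_nonneg s)) u := by
    filter_upwards [Measure.ae_ne _ (0 : ℝ)] with s hs
    have hmap := gaussianReal_map_div_const (μ := 0) (v := 1) s
    rw [zero_div] at hmap
    rw [← gaussianReal_apply, ← hmap, Measure.map_apply (by fun_prop) hB]
    · rfl
    · rw [← NNReal.coe_ne_zero]
      simp [hs]
  rw [lintegral_congr_ae hae, lintegral_lintegral_swap hmeas.aemeasurable]
  simp_rw [lintegral_cauchy]

lemma gaussian_prod_abs_lt {k : ℝ} (hk : 0 ≤ k) :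
    ((gaussianReal 0 1).prod (gaussianReal 0 1)) {z | |z.2| < k * |z.1|} =
      ENNReal.ofReal (2 / Real.pi * Real.arctan k) := by
  have : NullSingletonClass (gaussianReal 0 1) := nullSingletonClass_gaussianReal one_ne_zero
  have hae : {z : ℝ × ℝ | |z.2| < k * |z.1|} =ᵐ[(gaussianReal 0 1).prod (gaussianReal 0 1)]
      {z : ℝ × ℝ | z.2 / z.1 ∈ Set.Ioo (-k) k} := by
    have h0 : ∀ᵐ z ∂((gaussianReal 0 1).prod (gaussianReal 0 1)), z.1 ≠ 0 :=
      Measure.quasiMeasurePreserving_fst.ae (Measure.ae_ne _ (0 : ℝ))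
    filter_upwards [h0] with z hz
    refine propext ?_
    change |z.2| < k * |z.1| ↔ z.2 / z.1 ∈ Set.Ioo (-k) k
    rw [Set.mem_Ioo, ← abs_lt, abs_div, div_lt_iff₀ (abs_pos.2 hz)]
  have hint : Integrable (fun u : ℝ => Real.pi⁻¹ * (1 + u ^ 2)⁻¹) :=
    integrable_inv_one_add_sq.const_mul _
  rw [measure_congr hae, gaussian_prod_ratio measurableSet_Ioo,
    ← ofReal_integral_eq_lintegral_ofReal hint.integrableOn (.of_forall fun u => by positivity),
    ← integral_Ioc_eq_integral_Ioo, ← intervalIntegral.integral_of_le (by linarith),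
    intervalIntegral.integral_const_mul, integral_inv_one_add_sq, Real.arctan_neg]
  congr 1
  ring

lemma gaussian_prod_abs_eq (k : ℝ) :
    ((gaussianReal 0 1).prod (gaussianReal 0 1)) {z | |z.2| = k * |z.1|} = 0 := by
  have : NullSingletonClass (gaussianReal 0 1) := nullSingletonClass_gaussianReal one_ne_zero
  rw [Measure.measure_prod_null (measurableSet_eq_fun (by fun_prop) (by fun_prop))]
  refine .of_forall fun s => ?_
  refine Set.Finite.measure_zero ?_ _
  refine Set.Finite.subset (Set.toFinite {k * |s|, -(k * |s|)}) fun t ht => ?_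
  have ht : |t| = k * |s| := ht
  rcases abs_choice t with h | h <;> simp [← ht, h]

lemma stdGaussian_prod_map_planeCross {v : EuclideanSpace ℝ (Fin 2)} (hv : v ≠ 0) :
    ((stdGaussian (EuclideanSpace ℝ (Fin 2))).prod (stdGaussian (EuclideanSpace ℝ (Fin 2)))).map
      (fun z => (planeCross z.1 v / ‖v‖, planeCross z.2 v / ‖v‖)) =
    (gaussianReal 0 1).prod (gaussianReal 0 1) := by
  let L : StrongDual ℝ (EuclideanSpace ℝ (Fin 2)) :=
    ‖v‖⁻¹ • innerSL ℝ (!₂[v 1, -v 0] : EuclideanSpace ℝ (Fin 2))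
  have hL : ‖L‖ = 1 := by
    have : ‖(!₂[v 1, -v 0] : EuclideanSpace ℝ (Fin 2))‖ = ‖v‖ := by
      simp [EuclideanSpace.norm_eq, Fin.sum_univ_two, add_comm]
    rw [norm_smul, innerSL_apply_norm, this, norm_inv, norm_norm,
      inv_mul_cancel₀ (norm_ne_zero_iff.2 hv)]
  have hLv (u : EuclideanSpace ℝ (Fin 2)) : planeCross u v / ‖v‖ = L u := by
    rw [planeCross_eq_inner, div_eq_inv_mul]
    rfl
  simp_rw [hLv]
  have := Measure.map_prod_map (stdGaussian (EuclideanSpace ℝ (Fin 2)))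
    (stdGaussian (EuclideanSpace ℝ (Fin 2))) (f := L) (g := L) L.measurable L.measurable
  rw [stdGaussian_map_of_norm_eq_one hL] at this
  exact this.symm

@[fun_prop]
lemma measurable_planeCross {α : Type*} [MeasurableSpace α] {f g : α → EuclideanSpace ℝ (Fin 2)}
    (hf : Measurable f) (hg : Measurable g) : Measurable fun x => planeCross (f x) (g x) := by
  unfold planeCross
  fun_prop

@[fun_prop]
lemma measurable_signedArea {α : Type*} [MeasurableSpace α]
    {f g h : α → EuclideanSpace ℝ (Fin 2)} (hf : Measurable f) (hg : Measurable g)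
    (hh : Measurable h) : Measurable fun x => signedArea (f x) (g x) (h x) := by
  unfold signedArea
  fun_prop

lemma nullSingletonClass_stdGaussian :
    NullSingletonClass (stdGaussian (EuclideanSpace ℝ (Fin 2))) := by
  refine IsGaussian.nullSingletonClass fun x h => ?_
  have hvar := variance_dual_stdGaussian
    (innerSL ℝ (EuclideanSpace.single 0 1 : EuclideanSpace ℝ (Fin 2)))
  rw [h, variance_dirac, innerSL_apply_norm] at hvar
  simp at hvar

lemma signedArea_mul_signedArea (a b c d : EuclideanSpace ℝ (Fin 2)) :
    signedArea a c d * signedArea b c d =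
      2 * planeCross ((2 : ℝ)⁻¹ • (a + b - c - d)) ((√2)⁻¹ • (d - c)) ^ 2 -
        planeCross ((√2)⁻¹ • (a - b)) ((√2)⁻¹ • (d - c)) ^ 2 := by
  have hs : (√2)⁻¹ ^ 2 = (2 : ℝ)⁻¹ := by rw [inv_pow, Real.sq_sqrt (by norm_num)]
  have hs₄ : (√2)⁻¹ ^ 4 = (4 : ℝ)⁻¹ := by rw [show 4 = 2 * 2 from rfl, pow_mul, hs]; norm_num
  simp only [signedArea, planeCross, PiLp.sub_apply, PiLp.add_apply, PiLp.smul_apply, smul_eq_mul]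
  ring_nf
  simp only [hs, hs₄]
  ring

lemma abs_lt_sqrt_two_mul_abs_iff (s t : ℝ) : |t| < √2 * |s| ↔ 0 < 2 * s ^ 2 - t ^ 2 := by
  rw [← abs_of_nonneg (Real.sqrt_nonneg 2), ← abs_mul, ← sq_lt_sq, mul_pow,
    Real.sq_sqrt (by norm_num), sub_pos]

lemma abs_eq_sqrt_two_mul_abs_iff (s t : ℝ) : |t| = √2 * |s| ↔ 2 * s ^ 2 - t ^ 2 = 0 := by
  rw [← abs_of_nonneg (Real.sqrt_nonneg 2), ← abs_mul, ← sq_eq_sq_iff_abs_eq_abs,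
    mul_pow, Real.sq_sqrt (by norm_num), sub_eq_zero, eq_comm]

/-- The measure of an event that depends only on the sign of the product of the signed areas of
`a c d` and `b c d` reduces to a computation for two independent standard Gaussian variables. -/
lemma stdGaussian_pi_signedArea {S : Set ℝ} (hS : MeasurableSet S)
    (hscale : ∀ c x : ℝ, 0 < c → (c * x ∈ S ↔ x ∈ S)) :
    (Measure.pi fun _ : Fin 4 => stdGaussian (EuclideanSpace ℝ (Fin 2)))
      {x | signedArea (x 0) (x 2) (x 3) * signedArea (x 1) (x 2) (x 3) ∈ S} =
    ((gaussianReal 0 1).prod (gaussianReal 0 1)) {z | 2 * z.1 ^ 2 - z.2 ^ 2 ∈ S} := by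
  have hT : MeasurableSet {y : EuclideanSpace ℝ (Fin 2) × EuclideanSpace ℝ (Fin 2) ×
      EuclideanSpace ℝ (Fin 2) | 2 * planeCross y.2.1 y.1 ^ 2 - planeCross y.2.2 y.1 ^ 2 ∈ S} := by
    refine (Measurable.sub ?_ ?_) hS <;> fun_prop
  have hT' : MeasurableSet {z : ℝ × ℝ | 2 * z.1 ^ 2 - z.2 ^ 2 ∈ S} := by
    refine (Measurable.sub ?_ ?_) hS <;> fun_prop
  have := nullSingletonClass_stdGaussian
  simp_rw [signedArea_mul_signedArea]
  have h := congrArg (· {y | 2 * planeCross y.2.1 y.1 ^ 2 - planeCross y.2.2 y.1 ^ 2 ∈ S})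
    map_rotation_prod
  simp only at h
  rw [Measure.map_apply (by fun_prop) hT] at h
  refine h.trans ?_
  rw [Measure.prod_apply hT]
  have hae : ∀ᵐ v ∂(stdGaussian (EuclideanSpace ℝ (Fin 2))),
      ((stdGaussian (EuclideanSpace ℝ (Fin 2))).prod (stdGaussian (EuclideanSpace ℝ (Fin 2))))
        (Prod.mk v ⁻¹' {y | 2 * planeCross y.2.1 y.1 ^ 2 - planeCross y.2.2 y.1 ^ 2 ∈ S}) =
      ((gaussianReal 0 1).prod (gaussianReal 0 1)) {z | 2 * z.1 ^ 2 - z.2 ^ 2 ∈ S} := by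
    filter_upwards [Measure.ae_ne _ (0 : EuclideanSpace ℝ (Fin 2))] with v hv
    rw [← stdGaussian_prod_map_planeCross hv, Measure.map_apply (by fun_prop) hT']
    congr 1
    ext z
    simp only [Set.mem_preimage, Set.mem_ofPred_eq]
    have : ‖v‖ ≠ 0 := norm_ne_zero_iff.2 hv
    rw [show 2 * planeCross z.1 v ^ 2 - planeCross z.2 v ^ 2 =
      ‖v‖ ^ 2 * (2 * (planeCross z.1 v / ‖v‖) ^ 2 - (planeCross z.2 v / ‖v‖) ^ 2) by field_simp]
    exact hscale _ _ (by positivity)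
  rw [lintegral_congr_ae hae]
  simp

lemma stdGaussian_pi_signedArea_mul_pos :
    (Measure.pi fun _ : Fin 4 => stdGaussian (EuclideanSpace ℝ (Fin 2)))
      {x | 0 < signedArea (x 0) (x 2) (x 3) * signedArea (x 1) (x 2) (x 3)} =
    ENNReal.ofReal (2 / Real.pi * Real.arctan √2) := by
  have := stdGaussian_pi_signedArea (S := Set.Ioi 0) measurableSet_Ioi
    (fun c x hc => by simp [hc])
  simp only [Set.mem_Ioi] at this
  rw [this, ← gaussian_prod_abs_lt (Real.sqrt_nonneg 2)]
  simp_rw [abs_lt_sqrt_two_mul_abs_iff]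

lemma ae_signedArea_mul_ne_zero :
    ∀ᵐ x ∂(Measure.pi fun _ : Fin 4 => stdGaussian (EuclideanSpace ℝ (Fin 2))),
      signedArea (x 0) (x 2) (x 3) * signedArea (x 1) (x 2) (x 3) ≠ 0 := by
  have := stdGaussian_pi_signedArea (S := {0}) (measurableSet_singleton 0)
    (fun c x hc => by simp [hc.ne'])
  simp only [Set.mem_singleton_iff, ← abs_eq_sqrt_two_mul_abs_iff, gaussian_prod_abs_eq] at this
  simpa only [ae_iff, not_not] using this

lemma measurePreserving_pi_comp_perm {ι α : Type*} [Fintype ι] [MeasurableSpace α] (ν : Measure α)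
    [SigmaFinite ν] (σ : Equiv.Perm ι) :
    MeasurePreserving (fun (x : ι → α) i => x (σ i)) (Measure.pi fun _ : ι => ν)
      (Measure.pi fun _ : ι => ν) := by
  have := (measurePreserving_piCongrLeft (fun _ : ι => ν) σ).symm
  exact this

lemma stdGaussian_pi_signedArea_mul_pos_perm (σ : Equiv.Perm (Fin 4)) {i j k l : Fin 4}
    (hi : σ 0 = i) (hj : σ 1 = j) (hk : σ 2 = k) (hl : σ 3 = l) :
    (Measure.pi fun _ : Fin 4 => stdGaussian (EuclideanSpace ℝ (Fin 2)))
      {x | 0 < signedArea (x i) (x k) (x l) * signedArea (x j) (x k) (x l)} =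
    ENNReal.ofReal (2 / Real.pi * Real.arctan √2) := by
  subst hi hj hk hl
  have hmeas : MeasurableSet {x : Fin 4 → EuclideanSpace ℝ (Fin 2) |
      0 < signedArea (x 0) (x 2) (x 3) * signedArea (x 1) (x 2) (x 3)} := by
    refine measurableSet_lt measurable_const (Measurable.mul ?_ ?_) <;> fun_prop
  exact ((measurePreserving_pi_comp_perm (stdGaussian (EuclideanSpace ℝ (Fin 2)))
    σ).measure_preimage hmeas.nullMeasurableSet).trans stdGaussian_pi_signedArea_mul_pos

lemma ae_signedArea_mul_ne_zero_perm (σ : Equiv.Perm (Fin 4)) {i j k l : Fin 4}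
    (hi : σ 0 = i) (hj : σ 1 = j) (hk : σ 2 = k) (hl : σ 3 = l) :
    ∀ᵐ x ∂(Measure.pi fun _ : Fin 4 => stdGaussian (EuclideanSpace ℝ (Fin 2))),
      signedArea (x i) (x k) (x l) * signedArea (x j) (x k) (x l) ≠ 0 := by
  subst hi hj hk hl
  exact (measurePreserving_pi_comp_perm (stdGaussian (EuclideanSpace ℝ (Fin 2)))
    σ).quasiMeasurePreserving.ae ae_signedArea_mul_ne_zero

open scoped Classical in
lemma sum_ite_mul_pos {d₀ d₁ d₂ d₃ : ℝ} (h₀ : d₀ ≠ 0) (h₁ : d₁ ≠ 0) (h₂ : d₂ ≠ 0) (h₃ : d₃ ≠ 0)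
    (h : d₀ + d₂ = d₁ + d₃) :
    ((if 0 < d₀ * d₁ then 1 else 0) + (if 0 < -(d₀ * d₂) then 1 else 0) +
      (if 0 < d₀ * d₃ then 1 else 0) + (if 0 < d₁ * d₂ then 1 else 0) +
      (if 0 < -(d₁ * d₃) then 1 else 0) + (if 0 < d₂ * d₃ then 1 else 0) : ENNReal) =
    (if ¬ (0 < -(d₁ * d₂) ∧ 0 < d₁ * d₃ ∧ 0 < -(d₂ * d₃)) ∧
        ¬ (0 < d₀ * d₂ ∧ 0 < -(d₀ * d₃) ∧ 0 < -(d₂ * d₃)) ∧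
        ¬ (0 < -(d₀ * d₁) ∧ 0 < -(d₀ * d₃) ∧ 0 < d₁ * d₃) ∧
        ¬ (0 < -(d₀ * d₁) ∧ 0 < d₀ * d₂ ∧ 0 < -(d₁ * d₂)) then 1 else 0) + 3 := by
  rcases lt_or_gt_of_ne h₀ with h₀ | h₀ <;> rcases lt_or_gt_of_ne h₁ with h₁ | h₁ <;>
    rcases lt_or_gt_of_ne h₂ with h₂ | h₂ <;> rcases lt_or_gt_of_ne h₃ with h₃ | h₃ <;>
    first
    | (exfalso; linarith)
    | (simp only [Left.neg_pos_iff, mul_pos_iff, mul_neg_iff, h₀, h₁, h₂, h₃, h₀.not_gt, h₁.not_gt,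
        h₂.not_gt, h₃.not_gt]
       norm_num)

open scoped Classical in
lemma sum_ite_signedArea_mul_pos {x : Fin 4 → EuclideanSpace ℝ (Fin 2)}
    (h₀ : signedArea (x 1) (x 2) (x 3) ≠ 0) (h₁ : signedArea (x 0) (x 2) (x 3) ≠ 0)
    (h₂ : signedArea (x 0) (x 1) (x 3) ≠ 0) (h₃ : signedArea (x 0) (x 1) (x 2) ≠ 0) :
    ((if 0 < signedArea (x 0) (x 2) (x 3) * signedArea (x 1) (x 2) (x 3) then 1 else 0) +
      (if 0 < signedArea (x 0) (x 1) (x 3) * signedArea (x 2) (x 1) (x 3) then 1 else 0) +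
      (if 0 < signedArea (x 0) (x 2) (x 1) * signedArea (x 3) (x 2) (x 1) then 1 else 0) +
      (if 0 < signedArea (x 2) (x 0) (x 3) * signedArea (x 1) (x 0) (x 3) then 1 else 0) +
      (if 0 < signedArea (x 3) (x 2) (x 0) * signedArea (x 1) (x 2) (x 0) then 1 else 0) +
      (if 0 < signedArea (x 2) (x 0) (x 1) * signedArea (x 3) (x 0) (x 1) then 1 else 0) :
        ENNReal) =
    (if ∀ i, x i ∉ convexHull ℝ (x '' {i}ᶜ) then 1 else 0) + 3 := by
  have swap (a b c) : signedArea b a c = -signedArea a b c := by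
    simp [signedArea, planeCross]; ring
  have swap' (a b c) : signedArea a c b = -signedArea a b c := by
    simp [signedArea, planeCross]; ring
  have hsum : signedArea (x 1) (x 2) (x 3) + signedArea (x 0) (x 1) (x 3) =
      signedArea (x 0) (x 2) (x 3) + signedArea (x 0) (x 1) (x 2) := by
    simp [signedArea, planeCross]; ring
  have c₀ : ({0}ᶜ : Set (Fin 4)) = {1, 2, 3} := by ext i; fin_cases i <;> simp
  have c₁ : ({1}ᶜ : Set (Fin 4)) = {0, 2, 3} := by ext i; fin_cases i <;> simp
  have c₂ : ({2}ᶜ : Set (Fin 4)) = {0, 1, 3} := by ext i; fin_cases i <;> simp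
  have c₃ : ({3}ᶜ : Set (Fin 4)) = {0, 1, 2} := by ext i; fin_cases i <;> simp
  have s₁₀₃ := swap (x 0) (x 1) (x 3)
  have s₂₀₃ := swap (x 0) (x 2) (x 3)
  have s₂₁₃ := swap (x 1) (x 2) (x 3)
  have s₀₂₁ := swap' (x 0) (x 1) (x 2)
  have s₀₃₂ := swap' (x 0) (x 2) (x 3)
  have s₂₀₁ : signedArea (x 2) (x 0) (x 1) = signedArea (x 0) (x 1) (x 2) := by
    rw [swap, swap', neg_neg]
  have s₁₂₀ : signedArea (x 1) (x 2) (x 0) = signedArea (x 0) (x 1) (x 2) := by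
    rw [swap', swap, neg_neg]
  have s₃₀₁ : signedArea (x 3) (x 0) (x 1) = signedArea (x 0) (x 1) (x 3) := by
    rw [swap, swap', neg_neg]
  have s₃₁₂ : signedArea (x 3) (x 1) (x 2) = signedArea (x 1) (x 2) (x 3) := by
    rw [swap, swap', neg_neg]
  have s₃₂₁ : signedArea (x 3) (x 2) (x 1) = -signedArea (x 1) (x 2) (x 3) := by
    rw [swap', s₃₁₂]
  have s₃₂₀ : signedArea (x 3) (x 2) (x 0) = -signedArea (x 0) (x 2) (x 3) := by
    rw [swap', swap, swap', neg_neg]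
  simp only [Fin.forall_fin_succ, Fin.isValue, IsEmpty.forall_iff, and_true, Fin.succ_zero_eq_one,
    Fin.succ_one_eq_two, show Fin.succ (2 : Fin 3) = 3 from rfl, c₀, c₁, c₂, c₃,
    Set.image_insert_eq, Set.image_singleton]
  rw [mem_convexHull_triple_iff, mem_convexHull_triple_iff, mem_convexHull_triple_iff,
    mem_convexHull_triple_iff]
  · simp only [s₁₀₃, s₂₀₃, s₂₁₃, s₀₂₁, s₀₃₂, s₂₀₁, s₁₂₀, s₃₀₁, s₃₁₂, s₃₂₁, s₃₂₀, mul_neg,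
      neg_mul, neg_neg]
    rw [← sum_ite_mul_pos h₀ h₁ h₂ h₃ hsum]
    simp only [mul_comm]
  all_goals simpa only [s₁₀₃, s₂₀₃, s₂₁₃, s₀₂₁, s₀₃₂, s₂₀₁, s₁₂₀, s₃₀₁, s₃₁₂, s₃₂₁, s₃₂₀,
    neg_ne_zero]

theorem gaussian_sylvester_plane
    (stdGaussian : Measure (EuclideanSpace ℝ (Fin 2)))
    (hstd : stdGaussian = (Measure.pi fun _ : Fin 2 => gaussianReal 0 1).map
      (EuclideanSpace.equiv (Fin 2) ℝ).symm)
    (μ : Measure (Fin 4 → EuclideanSpace ℝ (Fin 2)))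
    (hμ : μ = Measure.pi fun _ : Fin 4 => stdGaussian) :
    μ {x | ∀ i, x i ∉ convexHull ℝ (x '' {i}ᶜ)}
      = ENNReal.ofReal (6 / Real.pi * Real.arcsin (1 / 3)) := by
  classical
  obtain rfl : stdGaussian = ProbabilityTheory.stdGaussian (EuclideanSpace ℝ (Fin 2)) :=
    hstd.trans map_pi_eq_stdGaussian
  have : IsProbabilityMeasure μ := by rw [hμ]; infer_instance
  let A (i j k l : Fin 4) : Set (Fin 4 → EuclideanSpace ℝ (Fin 2)) :=
    {x | 0 < signedArea (x i) (x k) (x l) * signedArea (x j) (x k) (x l)}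
  let C : Set (Fin 4 → EuclideanSpace ℝ (Fin 2)) := {x | ∀ i, x i ∉ convexHull ℝ (x '' {i}ᶜ)}
  have hAmeas (i j k l) : MeasurableSet (A i j k l) := by
    refine measurableSet_lt measurable_const (Measurable.mul ?_ ?_) <;> fun_prop
  let f (i j k l : Fin 4) : (Fin 4 → EuclideanSpace ℝ (Fin 2)) → ENNReal :=
    (A i j k l).indicator 1
  have hf (i j k l) : Measurable (f i j k l) := measurable_one.indicator (hAmeas i j k l)
  have hfint (σ : Equiv.Perm (Fin 4)) {i j k l : Fin 4} (hi : σ 0 = i) (hj : σ 1 = j)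
      (hk : σ 2 = k) (hl : σ 3 = l) :
      ∫⁻ x, f i j k l x ∂μ = ENNReal.ofReal (2 / Real.pi * Real.arctan √2) := by
    rw [lintegral_indicator_one (hAmeas i j k l), hμ]
    exact stdGaussian_pi_signedArea_mul_pos_perm σ hi hj hk hl
  let S : (Fin 4 → EuclideanSpace ℝ (Fin 2)) → ENNReal := fun x =>
    f 0 1 2 3 x + f 0 2 1 3 x + f 0 3 2 1 x + f 2 1 0 3 x + f 3 1 2 0 x + f 2 3 0 1 x
  have hS : ∀ᵐ x ∂μ, S x = C.indicator 1 x + 3 := by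
    have hne := ae_signedArea_mul_ne_zero_perm (Equiv.swap 0 2 * Equiv.swap 1 3)
      (i := 2) (j := 3) (k := 0) (l := 1) (by decide) (by decide) (by decide) (by decide)
    rw [hμ]
    filter_upwards [ae_signedArea_mul_ne_zero, hne] with x hx hx'
    have cyc (a b c) : signedArea c a b = signedArea a b c := by
      simp [signedArea, planeCross]; ring
    rw [cyc (x 0) (x 1) (x 2), cyc (x 0) (x 1) (x 3)] at hx'
    simp only [S, f, A, C, Set.indicator_apply, Pi.one_apply, Set.mem_ofPred_eq]
    convert sum_ite_signedArea_mul_pos (right_ne_zero_of_mul hx) (left_ne_zero_of_mul hx)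
      (right_ne_zero_of_mul hx') (left_ne_zero_of_mul hx')
  have hC : NullMeasurableSet C μ := by
    have hSm : MeasurableSet {x | S x = 4} :=
      (show Measurable S by fun_prop) (measurableSet_singleton 4)
    refine hSm.nullMeasurableSet.congr ?_
    filter_upwards [hS] with x hx
    refine propext ?_
    change S x = 4 ↔ x ∈ C
    rw [hx]
    by_cases h : x ∈ C <;> simp [h] <;> norm_num
  have key : ∫⁻ x, S x ∂μ = μ C + 3 := by
    rw [lintegral_congr_ae hS, lintegral_add_right _ measurable_const, lintegral_indicator_one₀ hC]
    simp
  simp only [S] at key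
  repeat rw [lintegral_add_right _ (hf _ _ _ _)] at key
  rw [hfint 1 (by decide) (by decide) (by decide) (by decide),
    hfint (Equiv.swap 1 2) (by decide) (by decide) (by decide) (by decide),
    hfint (Equiv.swap 1 3) (by decide) (by decide) (by decide) (by decide),
    hfint (Equiv.swap 0 2) (by decide) (by decide) (by decide) (by decide),
    hfint (Equiv.swap 0 3) (by decide) (by decide) (by decide) (by decide),
    hfint (Equiv.swap 0 2 * Equiv.swap 1 3) (by decide) (by decide) (by decide) (by decide)] at key
  have harc : 0 ≤ Real.arcsin (1 / 3) := Real.arcsin_nonneg.2 (by norm_num)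
  have hval : 2 / Real.pi * Real.arctan √2 = 1 / 2 + Real.arcsin (1 / 3) / Real.pi := by
    rw [div_mul_eq_mul_div, arctan_sqrt_two]
    field_simp
  rw [hval] at key
  have hq : 0 ≤ 1 / 2 + Real.arcsin (1 / 3) / Real.pi := by positivity
  rw [← ENNReal.ofReal_add, ← ENNReal.ofReal_add, ← ENNReal.ofReal_add, ← ENNReal.ofReal_add,
    ← ENNReal.ofReal_add] at key <;> try positivity
  have h3 : (3 : ENNReal) = ENNReal.ofReal 3 := by simp
  refine (ENNReal.add_left_inj (ENNReal.ofNat_ne_top (n := 3))).1 ?_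
  change μ C + 3 = _
  rw [← key, h3, ← ENNReal.ofReal_add (by positivity) (by norm_num)]
  congr 1
  ring
end

section
/- Five i.i.d. standard Gaussian points in ℝ³ are in convex position with probability 1/2 + (5/π)·arcsin(1/4). -/
open MeasureTheory ProbabilityTheory

/-- The `5 × 5` matrix whose rows are `v`, the all-ones vector and the three coordinates of the
points `x i`. -/
def affineMatrix (x : Fin 5 → EuclideanSpace ℝ (Fin 3)) (v : Fin 5 → ℝ) :
    Matrix (Fin 5) (Fin 5) ℝ :=
  Matrix.of ![v, 1, fun i => x i 0, fun i => x i 1, fun i => x i 2]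

lemma affineMatrix_eq_updateRow (x : Fin 5 → EuclideanSpace ℝ (Fin 3)) (v : Fin 5 → ℝ) :
    affineMatrix x v = (affineMatrix x 0).updateRow 0 v := by
  ext r i
  fin_cases r <;> rfl

/-- The linear functional whose values on the standard basis are the coefficients of the affine
dependence between the five points `x i`. -/
noncomputable def affineDet (x : Fin 5 → EuclideanSpace ℝ (Fin 3)) : (Fin 5 → ℝ) →ₗ[ℝ] ℝ where
  toFun v := (affineMatrix x v).det
  map_add' v w := by
    rw [affineMatrix_eq_updateRow, Matrix.det_updateRow_add, ← affineMatrix_eq_updateRow,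
      ← affineMatrix_eq_updateRow]
  map_smul' c v := by
    rw [affineMatrix_eq_updateRow, Matrix.det_updateRow_smul, ← affineMatrix_eq_updateRow]
    rfl

lemma affineDet_apply (x : Fin 5 → EuclideanSpace ℝ (Fin 3)) (v : Fin 5 → ℝ) :
    affineDet x v = (affineMatrix x v).det := rfl

/-- The coefficients of the affine dependence between the five points `x i`. -/
noncomputable def affineCoeff (x : Fin 5 → EuclideanSpace ℝ (Fin 3)) (i : Fin 5) : ℝ :=
  affineDet x (Pi.single i 1)

lemma sum_mul_affineCoeff (x : Fin 5 → EuclideanSpace ℝ (Fin 3)) (v : Fin 5 → ℝ) :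
    ∑ i, v i * affineCoeff x i = affineDet x v := by
  conv_rhs => rw [pi_eq_sum_univ' v]
  simp only [map_sum, map_smul, smul_eq_mul, affineCoeff]

lemma affineDet_one (x : Fin 5 → EuclideanSpace ℝ (Fin 3)) : affineDet x 1 = 0 :=
  Matrix.det_zero_of_row_eq (M := affineMatrix x 1) (i := 0) (j := 1) (by decide) rfl

lemma affineDet_coord (x : Fin 5 → EuclideanSpace ℝ (Fin 3)) (k : Fin 3) :
    affineDet x (fun i => x i k) = 0 := by
  have h (j : Fin 5) (hj : 0 ≠ j)
      (hr : affineMatrix x (fun i => x i k) 0 = affineMatrix x (fun i => x i k) j) :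
      affineDet x (fun i => x i k) = 0 := Matrix.det_zero_of_row_eq hj hr
  fin_cases k
  · exact h 2 (by decide) rfl
  · exact h 3 (by decide) rfl
  · exact h 4 (by decide) rfl

lemma sum_affineCoeff (x : Fin 5 → EuclideanSpace ℝ (Fin 3)) : ∑ i, affineCoeff x i = 0 := by
  simpa [affineDet_one] using sum_mul_affineCoeff x 1

lemma sum_affineCoeff_smul (x : Fin 5 → EuclideanSpace ℝ (Fin 3)) :
    ∑ i, affineCoeff x i • x i = 0 := by
  ext k
  have := sum_mul_affineCoeff x (fun i => x i k)
  rw [affineDet_coord] at this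
  simpa [mul_comm] using this

/-- An affine dependence is determined by any coefficient opposite to a nondegenerate simplex. -/
lemma affineCoeff_mul_eq {x : Fin 5 → EuclideanSpace ℝ (Fin 3)} {i : Fin 5}
    (hi : affineCoeff x i ≠ 0) {c : Fin 5 → ℝ} (hc : ∑ j, c j = 0) (hcx : ∑ j, c j • x j = 0)
    (j : Fin 5) : affineCoeff x i * c j = c i * affineCoeff x j := by
  set d : Fin 5 → ℝ := affineCoeff x i • c - c i • affineCoeff x with hd
  have hcx' (k : Fin 3) : ∑ j, x j k * c j = 0 := by
    simpa [mul_comm] using congrArg (fun y : EuclideanSpace ℝ (Fin 3) => y k) hcx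
  have hlx' (k : Fin 3) : ∑ j, x j k * affineCoeff x j = 0 := by
    simpa [mul_comm] using
      congrArg (fun y : EuclideanSpace ℝ (Fin 3) => y k) (sum_affineCoeff_smul x)
  have hdx (k : Fin 3) : ∑ j, x j k * d j = 0 := by
    simp only [hd, Pi.sub_apply, Pi.smul_apply, smul_eq_mul, mul_sub, mul_left_comm (x _ k),
      Finset.sum_sub_distrib, ← Finset.mul_sum, hcx', hlx']
    simp
  have hd0 : d = 0 := by
    refine Matrix.eq_zero_of_mulVec_eq_zero (M := affineMatrix x (Pi.single i 1))
      (by rwa [← affineDet_apply]) ?_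
    ext r
    fin_cases r
    · simp [affineMatrix, Matrix.mulVec, hd, mul_comm]
    · simp [affineMatrix, Matrix.mulVec, dotProduct, hd, ← Finset.mul_sum,
        sum_affineCoeff, hc]
    · exact hdx 0
    · exact hdx 1
    · exact hdx 2
  have := congrFun hd0 j
  simpa [hd, sub_eq_zero] using this

lemma mem_convexHull_image_iff {ι E : Type*} [Fintype ι] [AddCommGroup E] [Module ℝ E]
    (x : ι → E) (s : Set ι) (y : E) :
    y ∈ convexHull ℝ (x '' s) ↔ ∃ w : ι → ℝ, (∀ j, 0 ≤ w j) ∧ (∀ j ∉ s, w j = 0) ∧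
      ∑ j, w j = 1 ∧ ∑ j, w j • x j = y := by
  classical
  constructor
  · revert y
    refine convexHull_min (t := {y | ∃ w : ι → ℝ, (∀ j, 0 ≤ w j) ∧ (∀ j ∉ s, w j = 0) ∧
      ∑ j, w j = 1 ∧ ∑ j, w j • x j = y}) ?_ ?_
    · rintro _ ⟨j, hj, rfl⟩
      refine ⟨Pi.single j 1, fun k => ?_, fun k hk => ?_, by simp, ?_⟩
      · by_cases h : k = j
        · subst h; simp
        · simp [h]
      · exact Pi.single_eq_of_ne (by rintro rfl; exact hk hj) _
      · simp [Pi.single_apply, ite_smul]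
    · rintro _ ⟨w, hw, hws, hw1, rfl⟩ _ ⟨w', hw', hws', hw1', rfl⟩ a b ha hb hab
      refine ⟨fun j => a * w j + b * w' j, fun j => ?_, fun j hj => ?_, ?_, ?_⟩
      · have := hw j
        have := hw' j
        positivity
      · simp [hws j hj, hws' j hj]
      · rw [Finset.sum_add_distrib, ← Finset.mul_sum, ← Finset.mul_sum, hw1, hw1']
        simpa
      · simp [add_smul, mul_smul, Finset.sum_add_distrib, Finset.smul_sum]
  · rintro ⟨w, hw, hws, hw1, rfl⟩
    have h (j : ι) (hj : j ∉ Finset.univ.filter (· ∈ s)) : w j = 0 := hws j (by simpa using hj)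
    rw [← Finset.sum_subset (Finset.subset_univ _) fun j _ hj => h j hj] at hw1
    rw [← Finset.sum_subset (Finset.subset_univ (Finset.univ.filter (· ∈ s)))
      fun j _ hj => by rw [h j hj, zero_smul]]
    exact (convex_convexHull ℝ _).sum_mem (fun j _ => hw j) hw1 fun j hj =>
      subset_convexHull ℝ _ ⟨j, by simpa using hj, rfl⟩

/-- For points in general position, `x i` lies in the convex hull of the others precisely when its
coefficient in the affine dependence has the sign opposite to all the others. -/
lemma mem_convexHull_image_compl_iff {x : Fin 5 → EuclideanSpace ℝ (Fin 3)}
    (hx : ∀ i, affineCoeff x i ≠ 0) (i : Fin 5) :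
    x i ∈ convexHull ℝ (x '' {i}ᶜ) ↔ ∀ j, j ≠ i → affineCoeff x i * affineCoeff x j < 0 := by
  rw [mem_convexHull_image_iff]
  constructor
  · rintro ⟨w, hw, hwi, hw1, hwx⟩ j hj
    have hwi : w i = 0 := hwi i (by simp)
    have key := affineCoeff_mul_eq (hx i) (c := w - Pi.single i 1)
      (by simp [hw1]) (by simp [sub_smul, hwx, Pi.single_apply, ite_smul]) j
    simp only [Pi.sub_apply, Pi.single_eq_same, Pi.single_eq_of_ne hj, hwi] at key
    refine lt_of_le_of_ne ?_ (mul_ne_zero (hx i) (hx j))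
    have : affineCoeff x i * affineCoeff x j = - (affineCoeff x i ^ 2 * w j) := by
      linear_combination affineCoeff x i * key
    rw [this]
    have := hw j
    exact neg_nonpos.2 (by positivity)
  · intro h
    have hs := sum_affineCoeff x
    have hsx := sum_affineCoeff_smul x
    refine ⟨Pi.single i 1 - (affineCoeff x i)⁻¹ • affineCoeff x, fun j => ?_, fun j hj => ?_,
      ?_, ?_⟩
    · by_cases hj : j = i
      · subst hj; simp [hx]
      · have := h j hj
        have h2 : (affineCoeff x i)⁻¹ * affineCoeff x j =
            (affineCoeff x i * affineCoeff x j) / affineCoeff x i ^ 2 := by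
          field_simp [hx i]
        simp only [Pi.sub_apply, Pi.single_eq_of_ne hj, Pi.smul_apply, smul_eq_mul, h2, zero_sub]
        exact neg_nonneg.2 (div_nonpos_of_nonpos_of_nonneg this.le (sq_nonneg _))
    · obtain rfl : j = i := by simpa using hj
      simp [hx]
    · simp [← Finset.mul_sum, hs]
    · simp [sub_smul, Pi.single_apply, ite_smul, mul_smul, ← Finset.smul_sum, hsx]

/-- If the five coefficients are nonzero and sum to zero, the number of ordered pairs of opposite
sign determines whether one coefficient is opposite in sign to the four others. -/
lemma card_opposite_sign {a : Fin 5 → ℝ} (ha : ∀ i, a i ≠ 0) (hsum : ∑ i, a i = 0) :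
    (∑ i, ∑ j, if a i * a j < 0 then (1 : ℝ) else 0) =
      if (∀ i, ¬ ∀ j, j ≠ i → a i * a j < 0) then 12 else 8 := by
  have hlt (i j : Fin 5) : a i * a j < 0 ↔ decide (0 < a i) ≠ decide (0 < a j) := by
    rw [mul_neg_iff]
    rcases (ha i).lt_or_gt with h1 | h1 <;> rcases (ha j).lt_or_gt with h2 | h2 <;>
      simp [h1, h2, not_lt.2 h1.le, not_lt.2 h2.le]
  have hconst : ¬ ∀ i j, decide (0 < a i) = decide (0 < a j) := by
    intro h
    rcases (ha 0).lt_or_gt with h0 | h0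
    · have : ∀ i, a i < 0 := fun i => lt_of_le_of_ne
        (by simpa [h0.le, not_lt.2 h0.le] using h 0 i) (ha i)
      linarith [Finset.sum_neg (fun i (_ : i ∈ Finset.univ) => this i) ⟨0, by simp⟩]
    · have : ∀ i, 0 < a i := fun i => by simpa [h0] using h 0 i
      linarith [Finset.sum_pos (fun i (_ : i ∈ Finset.univ) => this i) ⟨0, by simp⟩]
  have key : ∀ s : Fin 5 → Bool, (¬ ∀ i j, s i = s j) →
      (∑ i, ∑ j, if s i ≠ s j then 1 else 0) =
        if (∀ i, ¬ ∀ j, j ≠ i → s i ≠ s j) then 12 else 8 := by decide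
  simp only [hlt]
  exact_mod_cast key (fun i => decide (0 < a i)) hconst

/-- Linear recombination of a family of points by the rows of a matrix. -/
def mixPoints {ι E : Type*} [Fintype ι] [AddCommGroup E] [Module ℝ E] (R : Matrix ι ι ℝ)
    (x : ι → E) (i : ι) : E :=
  ∑ j, R i j • x j

lemma affineMatrix_mixPoints {R : Matrix (Fin 5) (Fin 5) ℝ} (hR : R.mulVec 1 = 1)
    (x : Fin 5 → EuclideanSpace ℝ (Fin 3)) (v : Fin 5 → ℝ) :
    affineMatrix (mixPoints R x) (R.mulVec v) = affineMatrix x v * R.transpose := by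
  ext r i
  have h1 : ∑ j, R i j = 1 := by simpa [Matrix.mulVec, dotProduct] using congrFun hR i
  fin_cases r <;>
    simp [affineMatrix, mixPoints, Matrix.mul_apply, Matrix.mulVec, dotProduct, mul_comm, h1]

lemma affineDet_mixPoints {R : Matrix (Fin 5) (Fin 5) ℝ} (hR : R.mulVec 1 = 1)
    (x : Fin 5 → EuclideanSpace ℝ (Fin 3)) (v : Fin 5 → ℝ) :
    affineDet (mixPoints R x) (R.mulVec v) = R.det * affineDet x v := by
  rw [affineDet_apply, affineMatrix_mixPoints hR, Matrix.det_mul, Matrix.det_transpose, mul_comm,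
    affineDet_apply]

lemma dotProduct_mulVec_self {ι : Type*} [Fintype ι] [DecidableEq ι] {R : Matrix ι ι ℝ}
    (hR : R.transpose * R = 1) (c : ι → ℝ) : R.mulVec c ⬝ᵥ R.mulVec c = c ⬝ᵥ c := by
  rw [Matrix.dotProduct_mulVec, Matrix.vecMul_mulVec, hR, Matrix.vecMul_one]

/-- An orthogonal matrix acts isometrically on families of points. -/
noncomputable def mixPointsIsometry {ι κ : Type*} [Fintype ι] [DecidableEq ι] [Fintype κ]
    (R : Matrix ι ι ℝ) (hR : R.transpose * R = 1) :
    PiLp 2 (fun _ : ι => EuclideanSpace ℝ κ) ≃ₗᵢ[ℝ] PiLp 2 (fun _ : ι => EuclideanSpace ℝ κ) :=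
  LinearIsometry.toLinearIsometryEquiv
    { toFun := fun x => WithLp.toLp 2 (mixPoints R (WithLp.ofLp x))
      map_add' := fun x y => by
        ext i k; simp [mixPoints, Finset.sum_add_distrib]
      map_smul' := fun c x => by
        ext i k; simp [mixPoints, Finset.mul_sum, mul_left_comm]
      norm_map' := fun x => by
        rw [← sq_eq_sq₀ (norm_nonneg _) (norm_nonneg _), PiLp.norm_sq_eq_of_L2,
          PiLp.norm_sq_eq_of_L2]
        simp only [EuclideanSpace.norm_sq_eq]
        rw [Finset.sum_comm, Finset.sum_comm (s := Finset.univ (α := ι))]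
        refine Finset.sum_congr rfl fun k _ => ?_
        have := dotProduct_mulVec_self hR (fun i => x i k)
        simpa [dotProduct, Matrix.mulVec, mixPoints, ← pow_two] using this } rfl

lemma map_toLp_pi_stdGaussian {ι κ : Type*} [Fintype ι] [Fintype κ] :
    (Measure.pi fun _ : ι => stdGaussian (EuclideanSpace ℝ κ)).map (WithLp.toLp 2) =
      stdGaussian (PiLp 2 fun _ : ι => EuclideanSpace ℝ κ) := by
  have : IsFiniteMeasure ((Measure.pi fun _ : ι => stdGaussian (EuclideanSpace ℝ κ)).map
      (WithLp.toLp 2)) := Measure.isFiniteMeasure_map _ _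
  refine Measure.ext_of_charFun (E := PiLp 2 fun _ : ι => EuclideanSpace ℝ κ) ?_
  ext t
  simp_rw [charFun_pi, charFun_stdGaussian, ← Complex.exp_sum, ← Complex.ofReal_pow,
    PiLp.norm_sq_eq_of_L2]
  push_cast
  simp [neg_div, Finset.sum_div]

/-- A family of independent standard Gaussian vectors is invariant in law under orthogonal
recombination. -/
lemma measurePreserving_mixPoints {ι κ : Type*} [Fintype ι] [DecidableEq ι] [Fintype κ]
    {R : Matrix ι ι ℝ} (hR : R.transpose * R = 1) :
    MeasurePreserving (mixPoints R)
      (Measure.pi fun _ : ι => stdGaussian (EuclideanSpace ℝ κ))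
      (Measure.pi fun _ : ι => stdGaussian (EuclideanSpace ℝ κ)) := by
  have h1 : MeasurePreserving (MeasurableEquiv.toLp 2 (ι → EuclideanSpace ℝ κ))
      (Measure.pi fun _ : ι => stdGaussian (EuclideanSpace ℝ κ))
      (stdGaussian (PiLp 2 fun _ : ι => EuclideanSpace ℝ κ)) :=
    ⟨MeasurableEquiv.measurable _, map_toLp_pi_stdGaussian⟩
  have h2 : MeasurePreserving (mixPointsIsometry (κ := κ) R hR)
      (stdGaussian (PiLp 2 fun _ : ι => EuclideanSpace ℝ κ))
      (stdGaussian (PiLp 2 fun _ : ι => EuclideanSpace ℝ κ)) :=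
    ⟨(mixPointsIsometry R hR).continuous.measurable, stdGaussian_map _⟩
  exact (h1.symm _).comp (h2.comp h1)

/-- The rotation by angle `t` in the plane spanned by the orthonormal vectors `u` and `v`. -/
noncomputable def planeRotation {ι : Type*} [DecidableEq ι] (u v : ι → ℝ) (t : ℝ) :
    Matrix ι ι ℝ :=
  1 + (Real.cos t - 1) • (Matrix.vecMulVec u u + Matrix.vecMulVec v v) +
    Real.sin t • (Matrix.vecMulVec v u - Matrix.vecMulVec u v)

lemma planeRotation_mulVec {ι : Type*} [Fintype ι] [DecidableEq ι] (u v : ι → ℝ) (t : ℝ)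
    (w : ι → ℝ) :
    (planeRotation u v t).mulVec w =
      w + (Real.cos t - 1) • ((u ⬝ᵥ w) • u + (v ⬝ᵥ w) • v) +
        Real.sin t • ((u ⬝ᵥ w) • v - (v ⬝ᵥ w) • u) := by
  simp [planeRotation, Matrix.add_mulVec, Matrix.sub_mulVec, Matrix.smul_mulVec,
    Matrix.vecMulVec_mulVec]

lemma planeRotation_transpose {ι : Type*} [DecidableEq ι] (u v : ι → ℝ) (t : ℝ) :
    (planeRotation u v t).transpose = planeRotation u v (-t) := by
  simp [planeRotation, Matrix.transpose_vecMulVec, ← smul_neg]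

lemma planeRotation_transpose_mul_self {ι : Type*} [Fintype ι] [DecidableEq ι]
    {u v : ι → ℝ} (t : ℝ) (huu : u ⬝ᵥ u = 1) (hvv : v ⬝ᵥ v = 1)
    (huv : u ⬝ᵥ v = 0) :
    (planeRotation u v t).transpose * planeRotation u v t = 1 := by
  refine Matrix.ext_of_mulVec_single fun i => ?_
  have hvu : v ⬝ᵥ u = 0 := by rw [dotProduct_comm, huv]
  have hcs := Real.sin_sq_add_cos_sq t
  rw [planeRotation_transpose, ← Matrix.mulVec_mulVec, Matrix.one_mulVec, planeRotation_mulVec,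
    planeRotation_mulVec]
  simp only [dotProduct_add, dotProduct_sub, dotProduct_smul, huu, hvv, huv, hvu, Real.cos_neg,
    Real.sin_neg, smul_eq_mul]
  ext k
  simp only [Pi.add_apply, Pi.sub_apply, Pi.smul_apply, smul_eq_mul]
  linear_combination
    (u k * (u ⬝ᵥ Pi.single i 1) + v k * (v ⬝ᵥ Pi.single i 1)) * hcs

lemma volume_Ioc_inter_cos_sq_lt_sin_sq :
    volume ({s : ℝ | 3 * Real.cos s ^ 2 < 5 * Real.sin s ^ 2} ∩ Set.Ioc 0 Real.pi) =
      ENNReal.ofReal (Real.pi - Real.arccos (1 / 4)) := by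
  have hpi := Real.pi_pos
  have ha0 := Real.arccos_nonneg (1 / 4)
  have hapi := Real.arccos_le_pi (1 / 4)
  have hcos : Real.cos (Real.arccos (1 / 4)) = 1 / 4 :=
    Real.cos_arccos (by norm_num) (by norm_num)
  have hiff (s : ℝ) :
      3 * Real.cos s ^ 2 < 5 * Real.sin s ^ 2 ↔ Real.cos (2 * s) < 1 / 4 := by
    rw [Real.cos_two_mul, Real.sin_sq]
    constructor <;> intro h <;> linarith
  have hset : {s : ℝ | 3 * Real.cos s ^ 2 < 5 * Real.sin s ^ 2} ∩ Set.Ioc 0 Real.pi =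
      Set.Ioo (Real.arccos (1 / 4) / 2) (Real.pi - Real.arccos (1 / 4) / 2) := by
    ext s
    simp only [Set.mem_inter_iff, Set.mem_ofPred_eq, Set.mem_Ioc, Set.mem_Ioo, hiff]
    constructor
    · rintro ⟨h, h0, h1⟩
      constructor <;> by_contra! hs
      · have := Real.cos_le_cos_of_nonneg_of_le_pi (x := 2 * s) (y := Real.arccos (1 / 4))
          (by linarith) hapi (by linarith)
        linarith
      · have := Real.cos_le_cos_of_nonneg_of_le_pi (x := 2 * Real.pi - 2 * s)
          (y := Real.arccos (1 / 4)) (by linarith) hapi (by linarith)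
        rw [Real.cos_two_pi_sub] at this
        linarith
    · rintro ⟨h0, h1⟩
      refine ⟨?_, by linarith, by linarith⟩
      rcases le_total (2 * s) Real.pi with h | h
      · have := Real.cos_lt_cos_of_nonneg_of_le_pi (x := Real.arccos (1 / 4)) (y := 2 * s)
          ha0 h (by linarith)
        linarith
      · have := Real.cos_lt_cos_of_nonneg_of_le_pi (x := Real.arccos (1 / 4))
          (y := 2 * Real.pi - 2 * s) ha0 (by linarith) (by linarith)
        rw [Real.cos_two_pi_sub] at this
        linarith
  rw [hset, Real.volume_Ioo]
  congr 1
  ring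

/-- The directions of a double cone sweep out the same angle from every starting direction. -/
lemma volume_Ioc_inter_rotated_sq_lt_sq {a b : ℝ} (hab : a ≠ 0 ∨ b ≠ 0) :
    volume ({t : ℝ | 3 * (a * Real.cos t - b * Real.sin t) ^ 2 <
        5 * (b * Real.cos t + a * Real.sin t) ^ 2} ∩ Set.Ioc 0 Real.pi) =
      ENNReal.ofReal (Real.pi - Real.arccos (1 / 4)) := by
  obtain ⟨r, φ, hr, ha, hb⟩ : ∃ r φ : ℝ, 0 < r ∧ a = r * Real.cos φ ∧ b = r * Real.sin φ := by
    refine ⟨‖(⟨a, b⟩ : ℂ)‖, Complex.arg ⟨a, b⟩, ?_, ?_, ?_⟩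
    · rw [norm_pos_iff, ne_eq, Complex.ext_iff]
      simpa [not_and_or, ← imp_iff_not_or] using hab
    · simp [Complex.norm_mul_cos_arg]
    · simp [Complex.norm_mul_sin_arg]
  set H : Set ℝ := {s | 3 * Real.cos s ^ 2 < 5 * Real.sin s ^ 2} with hH
  have hHm : MeasurableSet H := measurableSet_lt (by fun_prop) (by fun_prop)
  have h1 : {t : ℝ | 3 * (a * Real.cos t - b * Real.sin t) ^ 2 <
        5 * (b * Real.cos t + a * Real.sin t) ^ 2} ∩ Set.Ioc 0 Real.pi =
      (fun t => t + φ) ⁻¹' (H ∩ Set.Ioc φ (φ + Real.pi)) := by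
    ext t
    have hcos : a * Real.cos t - b * Real.sin t = r * Real.cos (t + φ) := by
      rw [ha, hb, Real.cos_add]; ring
    have hsin : b * Real.cos t + a * Real.sin t = r * Real.sin (t + φ) := by
      rw [ha, hb, Real.sin_add]; ring
    have hr2 : 0 < r ^ 2 := by positivity
    simp only [hH, hcos, hsin, Set.mem_inter_iff, Set.mem_ofPred_eq, Set.mem_Ioc, Set.mem_preimage,
      mul_pow, mul_left_comm _ (r ^ 2), mul_lt_mul_iff_right₀ hr2]
    refine and_congr_right fun _ => and_congr ?_ ?_ <;> constructor <;> intro h <;> linarith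
  have hper (g : AddSubgroup.zmultiples Real.pi) : (fun x => g +ᵥ x) ⁻¹' H = H := by
    obtain ⟨_, n, rfl⟩ := g
    ext s
    simp only [hH, Set.mem_preimage, Set.mem_ofPred_eq, AddSubgroup.vadd_def, vadd_eq_add,
      zsmul_eq_mul]
    rw [add_comm, Real.cos_add_int_mul_pi, Real.sin_add_int_mul_pi, mul_pow, mul_pow,
      ← zpow_natCast, ← zpow_mul, mul_comm n, zpow_mul]
    simp
  have h2 : volume (H ∩ Set.Ioc φ (φ + Real.pi)) = volume (H ∩ Set.Ioc 0 (0 + Real.pi)) :=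
    (isAddFundamentalDomain_Ioc Real.pi_pos φ).measure_set_eq
      (isAddFundamentalDomain_Ioc Real.pi_pos 0) hHm hper
  rw [h1, measure_preimage_add_right, h2, zero_add, volume_Ioc_inter_cos_sq_lt_sin_sq]

/-- If the law of the planar vector `(A, B)` assigns the same probability to all the rotated copies
of a double cone, this probability is the normalised angle of the cone. -/
lemma measure_sq_lt_sq_of_rotation_invariant {X : Type*} [MeasurableSpace X] (μ : Measure X)
    [IsProbabilityMeasure μ] {A B : X → ℝ} (hA : Measurable A) (hB : Measurable B)
    (h0 : ∀ᵐ x ∂μ, A x ≠ 0 ∨ B x ≠ 0)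
    (hinv : ∀ t : ℝ, μ {x | 3 * (A x * Real.cos t - B x * Real.sin t) ^ 2 <
        5 * (B x * Real.cos t + A x * Real.sin t) ^ 2} = μ {x | 3 * A x ^ 2 < 5 * B x ^ 2}) :
    μ.real {x | 3 * A x ^ 2 < 5 * B x ^ 2} = 1 - Real.arccos (1 / 4) / Real.pi := by
  have hpi := Real.pi_pos
  set S : Set (ℝ × X) := {p | 3 * (A p.2 * Real.cos p.1 - B p.2 * Real.sin p.1) ^ 2 <
    5 * (B p.2 * Real.cos p.1 + A p.2 * Real.sin p.1) ^ 2} with hS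
  have hSm : MeasurableSet S := measurableSet_lt (by fun_prop) (by fun_prop)
  have h1 : ((volume.restrict (Set.Ioc 0 Real.pi)).prod μ) S =
      μ {x | 3 * A x ^ 2 < 5 * B x ^ 2} * ENNReal.ofReal Real.pi := by
    rw [Measure.prod_apply hSm]
    simp only [hS, Set.preimage_ofPred_eq, hinv]
    simp
  have h2 : ((volume.restrict (Set.Ioc 0 Real.pi)).prod μ) S =
      ENNReal.ofReal (Real.pi - Real.arccos (1 / 4)) := by
    rw [Measure.prod_apply_symm hSm]
    have : ∀ᵐ x ∂μ, volume.restrict (Set.Ioc 0 Real.pi) ((fun t => (t, x)) ⁻¹' S) =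
        ENNReal.ofReal (Real.pi - Real.arccos (1 / 4)) := by
      filter_upwards [h0] with x hx
      rw [Measure.restrict_apply' measurableSet_Ioc]
      exact volume_Ioc_inter_rotated_sq_lt_sq hx
    rw [lintegral_congr_ae this]
    simp
  have h3 := congrArg ENNReal.toReal (h1.symm.trans h2)
  rw [ENNReal.toReal_mul, ENNReal.toReal_ofReal hpi.le,
    ENNReal.toReal_ofReal (sub_nonneg.2 (Real.arccos_le_pi _))] at h3
  rw [measureReal_def]
  field_simp
  linarith

lemma absolutelyContinuous_pi_fin {α : Type*} [MeasurableSpace α] {μ ν : Measure α}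
    [SigmaFinite μ] [SigmaFinite ν] (h : μ ≪ ν) (n : ℕ) :
    (Measure.pi fun _ : Fin n => μ) ≪ Measure.pi fun _ : Fin n => ν := by
  induction n with
  | zero => rw [Measure.pi_of_empty, Measure.pi_of_empty]
  | succ n ih =>
    rw [← ((measurePreserving_piFinSuccAbove (fun _ : Fin (n + 1) => μ) 0).symm).map_eq,
      ← ((measurePreserving_piFinSuccAbove (fun _ : Fin (n + 1) => ν) 0).symm).map_eq]
    exact (h.prod ih).map (MeasurableEquiv.measurable _)

lemma stdGaussian_absolutelyContinuous (n : ℕ) :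
    stdGaussian (EuclideanSpace ℝ (Fin n)) ≪ volume := by
  rw [← map_pi_eq_stdGaussian, ← (PiLp.volume_preserving_toLp (Fin n)).map_eq]
  exact (absolutelyContinuous_pi_fin (gaussianReal_absolutelyContinuous 0 one_ne_zero) n).map
    (PiLp.volume_preserving_toLp (Fin n)).measurable

/-- A measurable set that every line in some fixed direction meets in a null set is null. -/
lemma measure_eq_zero_of_forall_line {E : Type*} [AddCommGroup E] [Module ℝ E]
    [MeasurableSpace E] [MeasurableAdd₂ E] [MeasurableSMul₂ ℝ E] (μ : Measure E) [SigmaFinite μ]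
    [μ.IsAddRightInvariant] {S : Set E} (hS : MeasurableSet S) (y : E)
    (h : ∀ x, volume {t : ℝ | x + t • y ∈ S} = 0) : μ S = 0 := by
  have hm : Measurable fun p : ℝ × E => p.2 + p.1 • y := by fun_prop
  have h1 : (volume.prod μ) ((fun p : ℝ × E => p.2 + p.1 • y) ⁻¹' S) = 0 := by
    rw [Measure.prod_apply_symm (hm hS)]
    exact (lintegral_congr h).trans lintegral_zero
  rw [Measure.prod_apply (hm hS)] at h1
  have h2 (t : ℝ) : μ (Prod.mk t ⁻¹' ((fun p : ℝ × E => p.2 + p.1 • y) ⁻¹' S)) = μ S :=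
    measure_preimage_add_right μ (t • y) S
  simpa [h2] using h1

lemma finite_det_add_smul_eq_zero {n : Type*} [Fintype n] [DecidableEq n] (A B : Matrix n n ℝ)
    (hB : B.det ≠ 0) : {t : ℝ | (A + t • B).det = 0}.Finite := by
  have hB' : IsUnit B.det := hB.isUnit
  refine (Polynomial.finite_setOfPred_isRoot
    (Matrix.charpoly_monic (-(B⁻¹ * A))).ne_zero).subset ?_
  intro t ht
  have : A + t • B = B * (Matrix.scalar n t - -(B⁻¹ * A)) := by
    rw [sub_neg_eq_add, mul_add, Matrix.mul_nonsing_inv_cancel_left _ _ hB', add_comm]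
    simp [← Matrix.smul_one_eq_diagonal]
  rw [Set.mem_ofPred_eq, this, Matrix.det_mul] at ht
  rw [Set.mem_ofPred_eq, Polynomial.IsRoot, Matrix.eval_charpoly]
  exact (mul_eq_zero.1 ht).resolve_left hB

lemma continuous_affineDet (v : Fin 5 → ℝ) :
    Continuous fun x : Fin 5 → EuclideanSpace ℝ (Fin 3) => affineDet x v := by
  refine Continuous.matrix_det (A := fun x => affineMatrix x v) (continuous_matrix fun r i => ?_)
  fin_cases r <;> simp only [affineMatrix, Matrix.of_apply] <;> fun_prop

lemma exists_affineCoeff_ne_zero (i : Fin 5) :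
    ∃ y : Fin 5 → EuclideanSpace ℝ (Fin 3), affineCoeff y i ≠ 0 := by
  refine ⟨fun j => !₂[(j : ℝ), (j : ℝ) ^ 2, (j : ℝ) ^ 3], ?_⟩
  rw [affineCoeff, affineDet_apply, Matrix.det_succ_row_zero]
  fin_cases i <;>
    simp [affineMatrix, Matrix.det_succ_row_zero, Fin.sum_univ_succ, Fin.succAbove] <;>
    norm_num [Fin.lt_def]

lemma affineMatrix_add_smul (x y : Fin 5 → EuclideanSpace ℝ (Fin 3)) (v : Fin 5 → ℝ) (t : ℝ) :
    (affineMatrix x v + t • affineMatrix y v).det =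
      (1 + t) ^ 2 * affineDet (x + t • y) v := by
  have : affineMatrix x v + t • affineMatrix y v =
      Matrix.of fun r j => (![1 + t, 1 + t, 1, 1, 1] : Fin 5 → ℝ) r *
        affineMatrix (x + t • y) v r j := by
    ext r j
    fin_cases r <;> simp [affineMatrix]; ring
  rw [this, Matrix.det_mul_column, affineDet_apply]
  simp [Fin.prod_univ_succ, pow_two]

/-- Independent standard Gaussian points are almost surely in general position. -/
lemma ae_affineCoeff_ne_zero (i : Fin 5) :
    ∀ᵐ x ∂(Measure.pi fun _ : Fin 5 => stdGaussian (EuclideanSpace ℝ (Fin 3))),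
      affineCoeff x i ≠ 0 := by
  have hac := absolutelyContinuous_pi_fin (stdGaussian_absolutelyContinuous 3) 5
  obtain ⟨y, hy⟩ := exists_affineCoeff_ne_zero i
  refine hac (?_ : volume {x | ¬ affineCoeff x i ≠ 0} = 0)
  simp only [not_not]
  refine measure_eq_zero_of_forall_line _ ?_ y fun x => ?_
  · exact (continuous_affineDet _).measurable (measurableSet_singleton 0)
  · refine ((finite_det_add_smul_eq_zero (affineMatrix x (Pi.single i 1))
      (affineMatrix y (Pi.single i 1)) (by rwa [← affineDet_apply])).subset
        fun t ht => ?_).measure_zero _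
    rw [Set.mem_ofPred_eq, affineMatrix_add_smul]
    exact mul_eq_zero_of_right _ ht

lemma affineDet_planeRotation {u v : Fin 5 → ℝ} (huu : u ⬝ᵥ u = 1) (hvv : v ⬝ᵥ v = 1)
    (huv : u ⬝ᵥ v = 0) (hu1 : u ⬝ᵥ 1 = 0) (hv1 : v ⬝ᵥ 1 = 0) (t : ℝ)
    (x : Fin 5 → EuclideanSpace ℝ (Fin 3)) :
    affineDet (mixPoints (planeRotation u v t) x) u = (planeRotation u v t).det *
        (affineDet x u * Real.cos t - affineDet x v * Real.sin t) ∧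
      affineDet (mixPoints (planeRotation u v t) x) v = (planeRotation u v t).det *
        (affineDet x v * Real.cos t + affineDet x u * Real.sin t) := by
  have hvu : v ⬝ᵥ u = 0 := by rw [dotProduct_comm, huv]
  have hcs := Real.sin_sq_add_cos_sq t
  have h1 : (planeRotation u v t).mulVec 1 = 1 := by simp [planeRotation_mulVec, hu1, hv1]
  constructor
  · have := affineDet_mixPoints h1 x (Real.cos t • u - Real.sin t • v)
    rw [show (planeRotation u v t).mulVec (Real.cos t • u - Real.sin t • v) = u by
      rw [planeRotation_mulVec]
      simp only [dotProduct_sub, dotProduct_smul, huu, hvv, huv, hvu, smul_eq_mul]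
      ext k
      simp only [Pi.add_apply, Pi.sub_apply, Pi.smul_apply, smul_eq_mul]
      linear_combination u k * hcs] at this
    rw [this]
    simp [mul_comm]
  · have := affineDet_mixPoints h1 x (Real.cos t • v + Real.sin t • u)
    rw [show (planeRotation u v t).mulVec (Real.cos t • v + Real.sin t • u) = v by
      rw [planeRotation_mulVec]
      simp only [dotProduct_add, dotProduct_smul, huu, hvv, huv, hvu, smul_eq_mul]
      ext k
      simp only [Pi.add_apply, Pi.sub_apply, Pi.smul_apply, smul_eq_mul]
      linear_combination v k * hcs] at this
    rw [this]
    simp [mul_comm]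

lemma measureReal_affineDet_sq_lt_sq {u v : Fin 5 → ℝ} (huu : u ⬝ᵥ u = 1) (hvv : v ⬝ᵥ v = 1)
    (huv : u ⬝ᵥ v = 0) (hu1 : u ⬝ᵥ 1 = 0) (hv1 : v ⬝ᵥ 1 = 0)
    (h0 : ∀ᵐ x ∂(Measure.pi fun _ : Fin 5 => stdGaussian (EuclideanSpace ℝ (Fin 3))),
      affineDet x u ≠ 0 ∨ affineDet x v ≠ 0) :
    (Measure.pi fun _ : Fin 5 => stdGaussian (EuclideanSpace ℝ (Fin 3))).real
        {x | 3 * affineDet x u ^ 2 < 5 * affineDet x v ^ 2} =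
      1 - Real.arccos (1 / 4) / Real.pi := by
  have hA := (continuous_affineDet u).measurable
  have hB := (continuous_affineDet v).measurable
  refine measure_sq_lt_sq_of_rotation_invariant _ hA hB h0 fun t => ?_
  have hR := planeRotation_transpose_mul_self t huu hvv huv
  rw [← (measurePreserving_mixPoints hR).measure_preimage
    (s := {x | 3 * affineDet x u ^ 2 < 5 * affineDet x v ^ 2})
    (measurableSet_lt (by fun_prop) (by fun_prop)).nullMeasurableSet]
  have hdet : 0 < (planeRotation u v t).det ^ 2 := by
    have := congrArg Matrix.det hR
    rw [Matrix.det_mul, Matrix.det_transpose, Matrix.det_one, ← pow_two] at this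
    rw [this]
    exact one_pos
  congr 1
  ext x
  obtain ⟨h1, h2⟩ := affineDet_planeRotation huu hvv huv hu1 hv1 t x
  simp only [Set.mem_preimage, Set.mem_ofPred_eq, h1, h2, mul_pow,
    mul_left_comm _ ((planeRotation u v t).det ^ 2), mul_lt_mul_iff_right₀ hdet]

/-- Two coefficients of the affine dependence between five independent standard Gaussian points have
opposite signs with probability `1 - arccos (1 / 4) / π`. -/
lemma measureReal_affineCoeff_mul_neg {i j : Fin 5} (hij : i ≠ j) :
    (Measure.pi fun _ : Fin 5 => stdGaussian (EuclideanSpace ℝ (Fin 3))).real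
        {x | affineCoeff x i * affineCoeff x j < 0} =
      1 - Real.arccos (1 / 4) / Real.pi := by
  obtain ⟨a, ha, ha2⟩ : ∃ a : ℝ, a ≠ 0 ∧ a ^ 2 = 6 / 5 :=
    ⟨Real.sqrt (6 / 5), by positivity, Real.sq_sqrt (by norm_num)⟩
  obtain ⟨b, hb, hb2⟩ : ∃ b : ℝ, b ≠ 0 ∧ b ^ 2 = 2 :=
    ⟨Real.sqrt 2, by positivity, Real.sq_sqrt (by norm_num)⟩
  set u : Fin 5 → ℝ := a⁻¹ •
    (Pi.single i 1 + Pi.single j 1 - (2 / 5 : ℝ) • 1) with hu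
  set v : Fin 5 → ℝ := b⁻¹ • (Pi.single i 1 - Pi.single j 1) with hv
  have hdetu (x : Fin 5 → EuclideanSpace ℝ (Fin 3)) :
      affineDet x u = a⁻¹ * (affineCoeff x i + affineCoeff x j) := by
    simp [hu, affineCoeff, affineDet_one]
  have hdetv (x : Fin 5 → EuclideanSpace ℝ (Fin 3)) :
      affineDet x v = b⁻¹ * (affineCoeff x i - affineCoeff x j) := by
    simp [hv, affineCoeff]
  have hset : {x : Fin 5 → EuclideanSpace ℝ (Fin 3) | affineCoeff x i * affineCoeff x j < 0} =
      {x | 3 * affineDet x u ^ 2 < 5 * affineDet x v ^ 2} := by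
    ext x
    rw [Set.mem_ofPred_eq, Set.mem_ofPred_eq, hdetu, hdetv, mul_pow, mul_pow, inv_pow, inv_pow,
      ha2, hb2]
    constructor <;> intro h <;> nlinarith
  have hone : (1 : Fin 5 → ℝ) ⬝ᵥ 1 = 5 := by simp [dotProduct]
  rw [hset]
  refine measureReal_affineDet_sq_lt_sq ?_ ?_ ?_ ?_ ?_ ?_
  · simp only [hu, dotProduct_smul, smul_dotProduct, dotProduct_sub, sub_dotProduct,
      dotProduct_add, add_dotProduct, single_dotProduct, dotProduct_single, hone]
    simp [hij, hij.symm]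
    field_simp
    linarith
  · simp only [hv, dotProduct_smul, dotProduct_sub, dotProduct_single]
    simp [hij, hij.symm]
    field_simp
    linarith
  · simp only [hu, hv, dotProduct_smul, dotProduct_sub, dotProduct_single]
    simp [hij, hij.symm]
  · simp only [hu, smul_dotProduct, sub_dotProduct, add_dotProduct, single_dotProduct, hone]
    norm_num
  · simp only [hv, smul_dotProduct, sub_dotProduct, single_dotProduct]
    norm_num
  · filter_upwards [ae_affineCoeff_ne_zero i] with x hx
    rw [hdetu, hdetv]
    by_contra! h
    have h1 := (mul_eq_zero.1 h.1).resolve_left (inv_ne_zero ha)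
    have h2 := (mul_eq_zero.1 h.2).resolve_left (inv_ne_zero hb)
    exact hx (by linarith)

lemma measureReal_not_exists_opposite_affineCoeff :
    (Measure.pi fun _ : Fin 5 => stdGaussian (EuclideanSpace ℝ (Fin 3))).real
        {x | ∀ i, ¬ ∀ j, j ≠ i → affineCoeff x i * affineCoeff x j < 0} =
      1 / 2 + 5 / Real.pi * Real.arcsin (1 / 4) := by
  set P := Measure.pi fun _ : Fin 5 => stdGaussian (EuclideanSpace ℝ (Fin 3))
  set S : Fin 5 → Fin 5 → Set (Fin 5 → EuclideanSpace ℝ (Fin 3)) := fun i j =>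
    {x | affineCoeff x i * affineCoeff x j < 0} with hS
  set Q : Set (Fin 5 → EuclideanSpace ℝ (Fin 3)) :=
    {x | ∀ i, ¬ ∀ j, j ≠ i → affineCoeff x i * affineCoeff x j < 0} with hQ
  have hm (i : Fin 5) : Measurable fun x => affineCoeff x i :=
    (continuous_affineDet _).measurable
  have hSm (i j : Fin 5) : MeasurableSet (S i j) :=
    measurableSet_lt ((hm i).mul (hm j)) measurable_const
  have hQm : MeasurableSet Q := by
    have : Q = ⋂ i, (⋂ j, ⋂ (_ : j ≠ i), S i j)ᶜ := by
      ext x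
      simp [hQ, hS]
    rw [this]
    exact .iInter fun i => (MeasurableSet.iInter fun j => .iInter fun _ => hSm i j).compl
  have hint {T : Set (Fin 5 → EuclideanSpace ℝ (Fin 3))} (hT : MeasurableSet T) :
      Integrable (T.indicator (1 : (Fin 5 → EuclideanSpace ℝ (Fin 3)) → ℝ)) P :=
    (integrable_const (1 : ℝ)).indicator hT
  have hae : (fun x => ∑ i, ∑ j, (S i j).indicator
        (1 : (Fin 5 → EuclideanSpace ℝ (Fin 3)) → ℝ) x) =ᵐ[P]
      fun x => 8 + 4 * Q.indicator (1 : (Fin 5 → EuclideanSpace ℝ (Fin 3)) → ℝ) x := by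
    filter_upwards [ae_all_iff.2 ae_affineCoeff_ne_zero] with x hx
    have := card_opposite_sign hx (sum_affineCoeff x)
    simp only [Set.indicator_apply, hS, hQ, Set.mem_ofPred_eq, Pi.one_apply]
    rw [this]
    split_ifs <;> norm_num
  have h1 := integral_congr_ae hae
  rw [integral_finsetSum _ fun i _ => integrable_finsetSum _ fun j _ => hint (hSm i j),
    integral_add (integrable_const _) ((hint hQm).const_mul _), integral_const_mul,
    integral_indicator_one hQm] at h1
  have h2 (i : Fin 5) : ∫ x, ∑ j, (S i j).indicator
      (1 : (Fin 5 → EuclideanSpace ℝ (Fin 3)) → ℝ) x ∂P =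
      4 * (1 - Real.arccos (1 / 4) / Real.pi) := by
    rw [integral_finsetSum _ fun j _ => hint (hSm i j)]
    simp only [integral_indicator_one (hSm i _)]
    have hii : P.real (S i i) = 0 := by
      have : S i i = ∅ := by
        ext x
        simpa [hS] using mul_self_nonneg (affineCoeff x i)
      simp [this]
    rw [← Finset.add_sum_erase _ _ (Finset.mem_univ i), hii,
      Finset.sum_congr rfl fun j hj =>
        measureReal_affineCoeff_mul_neg (Finset.ne_of_mem_erase hj).symm]
    simp [mul_sub]
  simp only [h2] at h1
  simp only [Finset.sum_const, Finset.card_univ, Fintype.card_fin, integral_const, probReal_univ,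
    smul_eq_mul, Real.arccos, nsmul_eq_mul] at h1
  have hpi := Real.pi_ne_zero
  have h3 : (Real.pi / 2 - Real.arcsin (1 / 4)) / Real.pi =
      1 / 2 - 1 / Real.pi * Real.arcsin (1 / 4) := by
    field_simp
  rw [h3] at h1
  push_cast at h1
  linear_combination (-1 / 4) * h1

theorem gaussian_sylvester_space
    (stdGaussian : Measure (EuclideanSpace ℝ (Fin 3)))
    (hstd : stdGaussian = (Measure.pi fun _ : Fin 3 => gaussianReal 0 1).map
      (EuclideanSpace.equiv (Fin 3) ℝ).symm)
    (μ : Measure (Fin 5 → EuclideanSpace ℝ (Fin 3)))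
    (hμ : μ = Measure.pi fun _ : Fin 5 => stdGaussian) :
    μ {x | ∀ i, x i ∉ convexHull ℝ (x '' {i}ᶜ)}
      = ENNReal.ofReal (1 / 2 + 5 / Real.pi * Real.arcsin (1 / 4)) := by
  obtain rfl : stdGaussian = ProbabilityTheory.stdGaussian (EuclideanSpace ℝ (Fin 3)) :=
    hstd.trans map_pi_eq_stdGaussian
  subst hμ
  rw [← measureReal_not_exists_opposite_affineCoeff, ofReal_measureReal]
  refine measure_congr ?_
  filter_upwards [ae_all_iff.2 ae_affineCoeff_ne_zero] with x hx
  exact propext (forall_congr' fun i => not_congr (mem_convexHull_image_compl_iff hx i))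
end
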